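/- Let p = 3 and let F be a field of characteristic 3 containing F_9. Let V = F³ = Fv ⊕ W be a direct sum of G-submodules for a finite subgroup G ⊆ SL(3, F), with dim_F W = 2, and suppose that, with respect to some basis of W, the image T(G)|_W of T(G) in GL(W) is isomorphic to SL(2, F_5) and T(G)|_W ⊆ SL(2, F_9). Then S(V)^G is Gorenstein if and only if for every g ∈ G there exist τ ∈ T(G) and a scalar ζ ∈ F with ζ^20 = 1 such that g|_W = ζ · (τ|_W); i.e., G|_W ⊆ ⟨T(G)|_W, ηI_W⟩ for η a primitive 20th root of unity. -/

import Mathlib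

noncomputable section
open CategoryTheory Matrix MvPolynomial

universe u

/-- A module `M` over `R` has finite injective dimension iff the Ext functors
`Ext^i(-, M)` vanish for all sufficiently large `i`. -/
def HasFiniteInjectiveDimension (R : Type u) [CommRing R] (M : ModuleCat.{u} R) : Prop :=
  ∃ n : ℕ, ∀ (N : ModuleCat.{u} R) (i : ℕ), n < i →
    Subsingleton (((Ext R (ModuleCat.{u} R) i).obj (Opposite.op N)).obj M)

/-- A commutative ring is Gorenstein if it is Noetherian and its localization at every
prime ideal has finite injective dimension over itself. -/
def IsGorensteinRing (R : Type u) [CommRing R] : Prop :=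
  IsNoetherianRing R ∧ ∀ (P : Ideal R) [P.IsPrime],
    HasFiniteInjectiveDimension (Localization.AtPrime P)
      (ModuleCat.of (Localization.AtPrime P) (Localization.AtPrime P))

/-- The substitution action of a matrix on polynomials: `X i ↦ ∑ j, M i j • X j`. -/
def polyAct {F : Type u} [CommSemiring F] {m : ℕ} (M : Matrix (Fin m) (Fin m) F) :
    MvPolynomial (Fin m) F →ₐ[F] MvPolynomial (Fin m) F :=
  MvPolynomial.aeval fun i => ∑ j, M i j • MvPolynomial.X j

/-- The subalgebra of polynomials invariant under a set of matrices. -/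
def invariantAlg {F : Type u} [CommSemiring F] {m : ℕ} (S : Set (Matrix (Fin m) (Fin m) F)) :
    Subalgebra F (MvPolynomial (Fin m) F) where
  carrier := {f | ∀ M ∈ S, polyAct M f = f}
  mul_mem' := fun hf hg => fun M hM => by rw [_root_.map_mul, hf M hM, hg M hM]
  add_mem' := fun hf hg => fun M hM => by rw [_root_.map_add, hf M hM, hg M hM]
  algebraMap_mem' := fun r => fun M hM => (polyAct M).commutes r

/-- The invariant ring `S(V)^G` for a subgroup `G` of `SL(m, F)`, where `S(V)` is realised
as the polynomial ring `F[X 0, …, X (m-1)]`. -/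
def invariantRing {F : Type u} [Field F] {m : ℕ}
    (G : Subgroup (Matrix.SpecialLinearGroup (Fin m) F)) :
    Subalgebra F (MvPolynomial (Fin m) F) :=
  invariantAlg {M | ∃ g ∈ G, (g : Matrix (Fin m) (Fin m) F) = M}

/-- A matrix `M` is a transvection if `rank (M - 1) = 1` and `(M - 1)² = 0`. -/
def IsTransvectionMat {F : Type u} [Field F] {m : ℕ} (M : Matrix (Fin m) (Fin m) F) : Prop :=
  (M - 1).rank = 1 ∧ (M - 1) * (M - 1) = 0

/-- `T(G)`: the subgroup generated by all transvections contained in `G`. -/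
def transSubgroup {F : Type u} [Field F] {m : ℕ}
    (G : Subgroup (Matrix.SpecialLinearGroup (Fin m) F)) :
    Subgroup (Matrix.SpecialLinearGroup (Fin m) F) :=
  Subgroup.closure {g | g ∈ G ∧ IsTransvectionMat (g : Matrix (Fin m) (Fin m) F)}

/-- The matrix of the restriction `g|W` of `g` to the coordinate plane
`W = span {e 1, e 2}` (with respect to the standard basis `{e 1, e 2}` of `W`). -/
def subW {F : Type u} [Field F] (g : Matrix.SpecialLinearGroup (Fin 3) F) :
    Matrix (Fin 2) (Fin 2) F :=
  Matrix.submatrix (g : Matrix (Fin 3) (Fin 3) F) Fin.succ Fin.succ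

/-- The matrix of `g|W` with respect to the basis of `W = span {e 1, e 2}` encoded by the
invertible change-of-basis matrix `P`. -/
def restrictW {F : Type u} [Field F] (P : (Matrix (Fin 2) (Fin 2) F)ˣ)
    (g : Matrix.SpecialLinearGroup (Fin 3) F) : Matrix (Fin 2) (Fin 2) F :=
  (↑P⁻¹ : Matrix (Fin 2) (Fin 2) F) * subW g * (↑P : Matrix (Fin 2) (Fin 2) F)

theorem subsingleton_ext_iff (R : Type u) [CommRing R] (N M : ModuleCat.{u} R) (i : ℕ) :
    Subsingleton (((Ext R (ModuleCat.{u} R) (i + 1)).obj (Opposite.op N)).obj M) ↔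
      Subsingleton (Abelian.Ext N M (i + 1)) := by
  let P := projectiveResolution N
  have h1 : Subsingleton (((Ext R (ModuleCat.{u} R) (i + 1)).obj (Opposite.op N)).obj M) ↔
      ∀ f : P.complex.X (i + 1) ⟶ M, P.complex.d (i + 2) (i + 1) ≫ f = 0 →
        ∃ g : P.complex.X i ⟶ M, P.complex.d (i + 1) i ≫ g = f := by
    rw [← ModuleCat.isZero_iff_subsingleton, (P.isoExt (R := R) (i + 1) M).isZero_iff,
      ← HomologicalComplex.exactAt_iff_isZero_homology,
      HomologicalComplex.exactAt_iff' _ i (i + 1) (i + 2) (by simp) (by simp),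
      ShortComplex.moduleCat_exact_iff]
    rfl
  rw [h1]
  constructor
  · intro h
    refine subsingleton_of_forall_eq 0 fun α => ?_
    obtain ⟨f, hf, rfl⟩ := P.extMk_surjective α (i + 2) rfl
    exact (P.extMk_eq_zero_iff f _ _ hf i rfl).2 (h f hf)
  · intro h f hf
    exact (P.extMk_eq_zero_iff f (i + 2) rfl hf i rfl).1 (Subsingleton.elim _ _)

theorem hasFiniteInjectiveDimension_iff (R : Type u) [CommRing R] (M : ModuleCat.{u} R) :
    HasFiniteInjectiveDimension R M ↔ ∃ n, HasInjectiveDimensionLE M n := by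
  constructor
  · rintro ⟨n, h⟩
    refine ⟨n, HasInjectiveDimensionLT.mk fun i hi Y e => ?_⟩
    obtain ⟨j, rfl⟩ : ∃ j, i = j + 1 := ⟨i - 1, by lia⟩
    have := (subsingleton_ext_iff R Y M j).1 (h Y (j + 1) (by lia))
    exact Subsingleton.elim _ _
  · rintro ⟨n, h⟩
    refine ⟨n, fun N i hi => ?_⟩
    obtain ⟨j, rfl⟩ : ∃ j, i = j + 1 := ⟨i - 1, by lia⟩
    exact (subsingleton_ext_iff R N M j).2
      (HasInjectiveDimensionLT.subsingleton M (n + 1) (j + 1) (by lia) N)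

theorem coextendScalars_hasInjectiveDimensionLE {B R : Type u} [CommRing B] [CommRing R]
    (f : B →+* R)
    (hproj : Module.Projective B ((ModuleCat.restrictScalars f).obj (ModuleCat.of R R)))
    (n : ℕ) (M : ModuleCat.{u} B) (h : HasInjectiveDimensionLE M n) :
    HasInjectiveDimensionLE ((ModuleCat.coextendScalars f).obj M) n := by
  have hinj : ∀ I : ModuleCat.{u} B, Injective I →
      HasInjectiveDimensionLT ((ModuleCat.coextendScalars f).obj I) 1 := fun I hI => by
    rw [← injective_iff_hasInjectiveDimensionLT_one]
    exact Injective.injective_of_adjoint (ModuleCat.restrictCoextendScalarsAdj.{u, u, u} f) I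
  induction n generalizing M with
  | zero =>
    exact hinj M (injective_iff_hasInjectiveDimensionLT_one.2 h)
  | succ n ih =>
    obtain ⟨p⟩ := EnoughInjectives.presentation M
    have hS := p.shortExact_shortComplex
    have hI := p.injective
    have hQ : HasInjectiveDimensionLT p.shortComplex.X₃ (n + 1) :=
      hS.hasInjectiveDimensionLT_X₃ (n + 1)
        (hasInjectiveDimensionLT_of_ge p.J 1 (n + 1) (by lia)) h
    have := hinj p.J p.injective
    have hI' : HasInjectiveDimensionLT ((ModuleCat.coextendScalars f).obj p.J) (n + 2) :=
      hasInjectiveDimensionLT_of_ge _ 1 (n + 2) (by lia)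
    have hQ' : HasInjectiveDimensionLT _ (n + 1) := ih p.shortComplex.X₃ hQ
    have hepi : (ModuleCat.coextendScalars.{u, u, u} f).PreservesEpimorphisms :=
      ⟨fun {X Y} g hg => by
        rw [ModuleCat.epi_iff_surjective] at hg ⊢
        intro y
        obtain ⟨l, hl⟩ := Module.projective_lifting_property g.hom
          (ModuleCat.CoextendScalars.equiv f Y y) hg
        exact ⟨(ModuleCat.CoextendScalars.equiv f X).symm l,
          ModuleCat.CoextendScalars.ext hl⟩⟩
    have : (ModuleCat.coextendScalars.{u, u, u} f).PreservesHomology :=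
      Functor.preservesHomology_of_preservesEpis_and_kernels _
    have := hS.mono_f
    have := hS.epi_g
    have hS' := hS.map (ModuleCat.coextendScalars.{u, u, u} f)
    exact hS'.hasInjectiveDimensionLT_X₁ (n + 1) hQ' hI'

/-- If `N` is the `R`-module coinduced from the `B`-module `M` (as witnessed by the evaluation
map `ev`) and `R` is projective over `B`, then coinduction does not increase the injective
dimension. -/
theorem hasInjectiveDimensionLE_of_coinduced {B R : Type u} [CommRing B] [CommRing R]
    [Algebra B R] [Module.Projective B R] {M N : Type u} [AddCommGroup M] [Module B M]
    [AddCommGroup N] [Module R N] (ev : N →+ M)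
    (hev : ∀ (b : B) (x : N), ev (algebraMap B R b • x) = b • ev x)
    (hinj : ∀ x : N, (∀ s : R, ev (s • x) = 0) → x = 0)
    (hsurj : ∀ ψ : R →ₗ[B] M, ∃ x : N, ∀ s : R, ev (s • x) = ψ s)
    (n : ℕ) (h : HasInjectiveDimensionLE (ModuleCat.of B M) n) :
    HasInjectiveDimensionLE (ModuleCat.of R N) n := by
  let eR : ((ModuleCat.restrictScalars (algebraMap B R)).obj (ModuleCat.of R R)) ≃ₗ[B] R :=
    { AddEquiv.refl R with
      map_smul' := fun b r => by
        rw [Algebra.smul_def]; rfl }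
  have hproj := Module.Projective.of_equiv eR.symm
  have key := coextendScalars_hasInjectiveDimensionLE (algebraMap B R) hproj n _ h
  let C := (ModuleCat.coextendScalars (algebraMap B R)).obj (ModuleCat.of B M)
  let T : N →ₗ[R] C :=
    { toFun := fun x => (ModuleCat.CoextendScalars.equiv _ _).symm
        ({ toFun := fun s : R => ev (s • x)
           map_add' := fun s t => by rw [add_smul, map_add]
           map_smul' := fun b s => by
             rw [RingHom.id_apply, ← hev, Algebra.smul_def, mul_smul] } ∘ₗ eR.toLinearMap)
      map_add' := fun x y => (ModuleCat.CoextendScalars.equiv _ _).injective <|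
        LinearMap.ext fun s : R => by
          change ev (s • (x + y)) = ev (s • x) + ev (s • y)
          rw [smul_add, map_add]
      map_smul' := fun r x => (ModuleCat.CoextendScalars.equiv _ _).injective <|
        LinearMap.ext fun s : R => by
          change ev (s • r • x) = ev ((s * r) • x)
          rw [mul_smul] }
  have hT : Function.Bijective T := by
    constructor
    · rw [← LinearMap.ker_eq_bot, LinearMap.ker_eq_bot']
      exact fun x hx => hinj x fun s => LinearMap.congr_fun
        (congrArg (ModuleCat.CoextendScalars.equiv (algebraMap B R) (ModuleCat.of B M)) hx) s
    · intro y
      obtain ⟨x, hx⟩ := hsurj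
        ((ModuleCat.CoextendScalars.equiv (algebraMap B R) (ModuleCat.of B M) y) ∘ₗ
          eR.symm.toLinearMap)
      exact ⟨x, (ModuleCat.CoextendScalars.equiv _ _).injective <| LinearMap.ext hx⟩
  exact (ModuleCat.hasInjectiveDimensionLE_iff_of_linearEquiv
    (M := ModuleCat.of R N) (N := C) (LinearEquiv.ofBijective T hT) n).2 key

/-- Every module over `R` has injective dimension at most `d`. -/
def GlobalDimensionLE (R : Type u) [CommRing R] (d : ℕ) : Prop :=
  ∀ N : ModuleCat.{u} R, HasInjectiveDimensionLE N d

theorem globalDimensionLE_field (K : Type u) [Field K] : GlobalDimensionLE K 0 := fun N => by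
  have : Injective N := by
    rw [← Module.injective_iff_injective_object]
    refine ⟨fun P Q _ _ _ _ f hf g => ?_⟩
    obtain ⟨l, hl⟩ := f.exists_leftInverse_of_injective (LinearMap.ker_eq_bot.2 hf)
    exact ⟨g ∘ₗ l, fun x => congrArg g (LinearMap.congr_fun hl x)⟩
  exact (injective_iff_hasInjectiveDimensionLT_one).1 this

theorem GlobalDimensionLE.of_ringEquiv {R S : Type u} [CommRing R] [CommRing S] {d : ℕ}
    (h : GlobalDimensionLE R d) (e : R ≃+* S) : GlobalDimensionLE S d := fun N => by
  let : RingHomInvPair (RingHomClass.toRingHom e) (RingHomClass.toRingHom e.symm) :=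
    RingHomInvPair.of_ringEquiv e
  let : RingHomInvPair (RingHomClass.toRingHom e.symm) (RingHomClass.toRingHom e) :=
    RingHomInvPair.of_ringEquiv e.symm
  let : Module R N := Module.compHom N (e : R →+* S)
  refine (ModuleCat.hasInjectiveDimensionLE_iff_of_semiLinearEquiv e (M := ModuleCat.of R N)
    (N := N) ?_ d).1 (h _)
  exact { AddEquiv.refl N with map_smul' := fun r x => rfl }

open Polynomial in
theorem GlobalDimensionLE.polynomial {C : Type u} [CommRing C] {d : ℕ}
    (h : GlobalDimensionLE C d) : GlobalDimensionLE C[X] (d + 1) := fun N => by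
  let : Module C N := Module.compHom N (Polynomial.C : C →+* C[X])
  have : IsScalarTower C C[X] N := ⟨fun c p x => by
    rw [Polynomial.smul_eq_C_mul, mul_smul]; rfl⟩
  let S : Module.End C (ℕ → N) :=
    { toFun := fun a k => a (k + 1), map_add' := fun _ _ => rfl, map_smul' := fun _ _ => rfl }
  let A := Module.AEval' S
  let o := Module.AEval'.of S
  have ho : ∀ a, (Polynomial.X : C[X]) • o a = o (S a) := fun a => Module.AEval'.X_smul_of S a
  have hoc : ∀ (c : C) a, (Polynomial.C c : C[X]) • o a = o (c • a) := fun c a => by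
    rw [map_smul, ← Polynomial.algebraMap_eq, algebraMap_smul]
  have lin : ∀ {P Q : Type u} [AddCommGroup P] [AddCommGroup Q] [Module C[X] P] [Module C[X] Q]
      (φ : P →+ Q), (∀ (c : C) x, φ ((Polynomial.C c) • x) = (Polynomial.C c) • φ x) →
      (∀ x, φ ((Polynomial.X : C[X]) • x) = (Polynomial.X : C[X]) • φ x) → ∀ (p : C[X]) x, φ (p • x) = p • φ x := by
    intro P Q _ _ _ _ φ h1 h2 p
    induction p using Polynomial.induction_on with
    | C c => exact h1 c
    | add p q hp hq => intro x; rw [add_smul, add_smul, map_add, hp, hq]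
    | monomial n c hp =>
      intro x
      rw [pow_succ, ← mul_assoc, mul_smul, hp, h2, mul_smul _ (Polynomial.X : C[X])]
  have hA : HasInjectiveDimensionLE (ModuleCat.of C[X] A) d := by
    have hX : ∀ (k : ℕ) a, o.symm ((Polynomial.X : C[X]) ^ k • o a) 0 = a k := by
      intro k
      induction k with
      | zero => simp
      | succ k ih => 
        intro a
        rw [pow_succ, mul_smul, ho, ih]; rfl
    refine hasInjectiveDimensionLE_of_coinduced (B := C) (M := N)
      (((Pi.evalAddMonoidHom _ 0).comp o.symm.toAddEquiv.toAddMonoidHom : A →+ N)) ?_ ?_ ?_ d (h _)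
    · intro b x
      obtain ⟨a, rfl⟩ := o.surjective x
      change o.symm ((Polynomial.C b : C[X]) • o a) 0 = b • o.symm (o a) 0
      rw [hoc, o.symm_apply_apply, o.symm_apply_apply]; rfl
    · intro x hx
      obtain ⟨a, rfl⟩ := o.surjective x
      have : a = 0 := funext fun k => (hX k a).symm.trans (hx ((Polynomial.X : C[X]) ^ k))
      rw [this, map_zero]
    · intro ψ
      refine ⟨o fun k => ψ ((Polynomial.X : C[X]) ^ k), fun s => ?_⟩
      induction s using Polynomial.induction_on' with
      | add p q hp hq => rw [add_smul, map_add, map_add, hp, hq]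
      | monomial n c =>
        rw [← Polynomial.C_mul_X_pow_eq_monomial, mul_smul, ← Polynomial.smul_eq_C_mul, ψ.map_smul]
        obtain ⟨b, hb⟩ := o.surjective ((Polynomial.X : C[X]) ^ n • o fun k => ψ (Polynomial.X ^ k))
        have := hX n fun k => ψ (Polynomial.X ^ k)
        rw [← hb] at this ⊢
        rw [o.symm_apply_apply] at this
        change o.symm ((Polynomial.C c : C[X]) • o b) 0 = c • ψ _
        rw [hoc, o.symm_apply_apply, ← this]; rfl
  let ι₀ : N →+ A :=
    { toFun := fun x => o fun k => (Polynomial.X : C[X]) ^ k • x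
      map_zero' := by simp only [smul_zero]; exact map_zero o
      map_add' := fun x y => by simp only [smul_add]; exact map_add o _ _ }
  have hι₀ : ∀ x, ι₀ x = o fun k => (Polynomial.X : C[X]) ^ k • x := fun _ => rfl
  let ι : N →ₗ[C[X]] A := 
    { ι₀ with
      map_smul' := lin ι₀ (fun c x => by
          change o _ = Polynomial.C c • o _
          rw [hoc]
          congr 1
          funext k
          exact smul_comm _ (Polynomial.C c) x)
        (fun x => by
          change o _ = (Polynomial.X : C[X]) • o _
          rw [ho]
          congr 1
          funext k
          change (Polynomial.X : C[X]) ^ k • (Polynomial.X : C[X]) • x = (Polynomial.X : C[X]) ^ (k + 1) • x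
          rw [pow_succ, mul_smul]) }
  let δ₀ : A →+ A :=
    { toFun := fun a => o fun k => o.symm a (k + 1) - (Polynomial.X : C[X]) • o.symm a k
      map_zero' := by
        rw [map_zero, ← map_zero o]
        congr 1
        funext k
        simp
      map_add' := fun x y => by
        rw [map_add, ← map_add o]
        congr 1
        funext k
        simp only [Pi.add_apply, smul_add]
        abel }
  have hδ : ∀ a, δ₀ (o a) = o fun k => a (k + 1) - (Polynomial.X : C[X]) • a k := fun a => by
    change o (fun k => o.symm (o a) (k + 1) - (Polynomial.X : C[X]) • o.symm (o a) k) = _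
    rw [o.symm_apply_apply]
  let δ : A →ₗ[C[X]] A := 
    { δ₀ with
      map_smul' := lin δ₀ (fun c x => by
          obtain ⟨a, rfl⟩ := o.surjective x
          rw [hoc, hδ, hδ, hoc]
          congr 1
          funext k
          change Polynomial.C c • a (k + 1) - (Polynomial.X : C[X]) • Polynomial.C c • a k =
            Polynomial.C c • (a (k + 1) - (Polynomial.X : C[X]) • a k)
          rw [smul_sub, smul_comm (Polynomial.X : C[X])])
        (fun x => by
          obtain ⟨a, rfl⟩ := o.surjective x
          rw [ho, hδ, hδ, ho]
          rfl) }
  have hex : Function.Exact ι δ := by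
    intro x
    obtain ⟨a, rfl⟩ := o.surjective x
    change δ₀ (o a) = 0 ↔ ∃ y, ι₀ y = o a
    simp only [hδ, hι₀]
    constructor
    · intro h
      have h1 : ∀ k, a (k + 1) = (Polynomial.X : C[X]) • a k := fun k =>
        sub_eq_zero.1 (congrFun (o.injective (h.trans (map_zero o).symm)) k)
      refine ⟨a 0, congrArg o (funext fun k => ?_)⟩
      induction k with
      | zero => rw [pow_zero, one_smul]
      | succ k ih => rw [h1, ← ih, pow_succ', mul_smul]
    · rintro ⟨y, hy⟩
      obtain rfl := o.injective hy
      rw [← map_zero o]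
      congr 1
      funext k
      change (Polynomial.X : C[X]) ^ (k + 1) • y - (Polynomial.X : C[X]) • Polynomial.X ^ k • y = 0
      rw [pow_succ', mul_smul, sub_self]
  have hι : Function.Injective ι := fun x y hxy => by
    have := congrFun (o.injective ((hι₀ x).symm.trans (hxy.trans (hι₀ y)))) 0
    simpa only [pow_zero, one_smul] using this
  have hδs : Function.Surjective δ := fun x => by
    obtain ⟨a, rfl⟩ := o.surjective x
    refine ⟨o fun k => Nat.rec (motive := fun _ => N) 0 (fun k b => a k + (Polynomial.X : C[X]) • b) k, ?_⟩
    refine (hδ _).trans (congrArg o (funext fun k => ?_))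
    exact add_sub_cancel_right _ _
  have hS := ModuleCat.shortComplex_shortExact
    (ModuleCat.shortComplexOfCompEqZero ι δ hex.linearMap_comp_eq_zero) hex hι hδs
  exact hS.hasInjectiveDimensionLT_X₁ (d + 1) hA
    (hasInjectiveDimensionLT_of_ge _ (d + 1) (d + 2) (by lia))

theorem globalDimensionLE_mvPolynomial_fin (K : Type u) [Field K] (n : ℕ) :
    GlobalDimensionLE (MvPolynomial (Fin n) K) n := by
  induction n with
  | zero =>
    have e := (MvPolynomial.isEmptyRingEquiv K (Fin 0)).symm
    exact (globalDimensionLE_field K).of_ringEquiv e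
  | succ n ih =>
    have e := (MvPolynomial.finSuccEquiv K n).symm.toRingEquiv
    exact ih.polynomial.of_ringEquiv e

theorem isGorensteinRing_of_hasInjectiveDimensionLE {R : Type u} [CommRing R] [IsNoetherianRing R]
    (d : ℕ) (h : HasInjectiveDimensionLE (ModuleCat.of R R) d) : IsGorensteinRing R := by
  refine ⟨inferInstance, fun P _ => (hasFiniteInjectiveDimension_iff _ _).2 ⟨d, ?_⟩⟩
  have h1 := ModuleCat.localizedModule_hasInjectiveDimensionLE d P.primeCompl (ModuleCat.of R R)
  refine (ModuleCat.hasInjectiveDimensionLE_iff_of_linearEquiv ?_ d).1 h1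
  have h2 := ModuleCat.localizedModule_isLocalizedModule (ModuleCat.of R R) P.primeCompl
  let e : (ModuleCat.of R R).localizedModule P.primeCompl ≃ₗ[R] Localization.AtPrime P :=
    @IsLocalizedModule.linearEquiv R _ P.primeCompl R _ (Localization.AtPrime P) _ _ _ _ _ _
      ((ModuleCat.of R R).localizedModuleMkLinearMap P.primeCompl)
      (Algebra.linearMap R (Localization.AtPrime P)) h2 inferInstance
  exact e.extendScalarsOfIsLocalization P.primeCompl (Localization.AtPrime P)

/-- A ring admitting a Frobenius system over a Noetherian ring of finite global dimension is
Gorenstein. -/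
theorem isGorensteinRing_of_frobenius {B R : Type u} [CommRing B] [IsNoetherianRing B]
    [CommRing R] [Algebra B R] {d : ℕ} (hB : GlobalDimensionLE B d) (φ : R →ₗ[B] B)
    {ι : Type*} [Fintype ι] (u v : ι → R) (h : ∀ r, ∑ j, φ (r * v j) • u j = r) :
    IsGorensteinRing R := by
  let i : R →ₗ[B] (ι → B) := LinearMap.pi fun j => φ ∘ₗ LinearMap.mulRight B (v j)
  let s : (ι → B) →ₗ[B] R := Fintype.linearCombination B u
  have hsi : s ∘ₗ i = LinearMap.id := LinearMap.ext fun r => h r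
  have : Module.Projective B R := Module.Projective.of_split i s hsi
  have : Module.Finite B R := Module.Finite.of_surjective s fun r => ⟨i r, h r⟩
  have : IsNoetherianRing R := IsNoetherianRing.of_finite B R
  refine isGorensteinRing_of_hasInjectiveDimensionLE d
    (hasInjectiveDimensionLE_of_coinduced (B := B) (M := B) φ.toAddMonoidHom ?_ ?_ ?_ d (hB _))
  · intro b x
    exact (congrArg φ (algebraMap_smul R b x)).trans (φ.map_smul b x)
  · intro x hx
    rw [← h x]
    refine Finset.sum_eq_zero fun j _ => ?_
    have : φ (v j * x) = 0 := hx (v j)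
    rw [mul_comm, this, zero_smul]
  · intro ψ
    refine ⟨∑ j, ψ (u j) • v j, fun r => ?_⟩
    change φ (r * _) = _
    conv_rhs => rw [← h r]
    simp only [Finset.mul_sum, map_sum, mul_smul_comm, map_smul, smul_eq_mul, mul_comm]

section
open Pointwise

theorem ext_comp_smul_eq_zero {R : Type u} [CommRing R] {N M : ModuleCat.{u} R} {r : R}
    (hr : ∀ x : N, r • x = 0) {n : ℕ} (x : Abelian.Ext N M n) :
    x.comp (Abelian.Ext.mk₀ (r • 𝟙 M)) (add_zero n) = 0 := by
  have h0 : r • 𝟙 N = 0 := by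
    ext x; exact hr x
  have h1 : (Abelian.Ext.mk₀ (r • 𝟙 N)).comp x (zero_add n) = 0 := by rw [h0]; simp
  simpa [Abelian.Ext.mk₀_smul] using h1

/-- The extension class of `0 → M → M → M ⧸ r • M → 0` for an `M`-regular element `r`. -/
def smulExtClass {R : Type u} [CommRing R] {M : ModuleCat.{u} R} {r : R}
    (hM : IsSMulRegular M r) : Abelian.Ext (ModuleCat.smulShortComplex M r).X₃ M 1 :=
  hM.smulShortComplex_shortExact.extClass

theorem exists_comp_extClass_smulShortComplex {R : Type u} [CommRing R] {N M : ModuleCat.{u} R}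
    {r : R} (hM : IsSMulRegular M r) (hr : ∀ x : N, r • x = 0) {n m : ℕ} (h : n + 1 = m)
    (x : Abelian.Ext N M m) :
    ∃ y : Abelian.Ext N (ModuleCat.smulShortComplex M r).X₃ n,
      y.comp (smulExtClass hM) h = x :=
  Abelian.Ext.covariant_sequence_exact₁ N hM.smulShortComplex_shortExact x
    (ext_comp_smul_eq_zero hr x) h

theorem eq_zero_of_comp_extClass {R : Type u} [CommRing R] {N M : ModuleCat.{u} R}
    {r : R} (hM : IsSMulRegular M r) {n m : ℕ} (h : n + 1 = m)
    (hN : ∀ x : Abelian.Ext N M n, x = 0)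
    (y : Abelian.Ext N (ModuleCat.smulShortComplex M r).X₃ n)
    (hy : y.comp (smulExtClass hM) h = 0) : y = 0 := by
  obtain ⟨x, rfl⟩ := Abelian.Ext.covariant_sequence_exact₃ N hM.smulShortComplex_shortExact y h hy
  have hx : (x : Abelian.Ext N (ModuleCat.smulShortComplex M r).X₂ n) = 0 := hN x
  rw [hx, Abelian.Ext.zero_comp]

theorem ext_succ_eq_zero {R : Type u} [CommRing R] {N M : ModuleCat.{u} R}
    {r : R} (hM : IsSMulRegular M r) (hr : ∀ x : N, r • x = 0) {n m : ℕ} (h : n + 1 = m)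
    (hN : ∀ x : Abelian.Ext N (ModuleCat.smulShortComplex M r).X₃ n, x = 0)
    (y : Abelian.Ext N M m) : y = 0 := by
  obtain ⟨x, rfl⟩ := exists_comp_extClass_smulShortComplex hM hr h y
  rw [hN x, Abelian.Ext.zero_comp]

theorem ext_zero_eq_zero {R : Type u} [CommRing R] {N M : ModuleCat.{u} R}
    {r : R} (hM : IsSMulRegular M r) (hr : ∀ x : N, r • x = 0) (y : Abelian.Ext N M 0) :
    y = 0 := by
  obtain ⟨f, rfl⟩ := Abelian.Ext.addEquiv₀.symm.surjective y
  have : f = 0 := by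
    ext x
    refine hM (?_ : r • f.hom x = r • (0 : M))
    rw [← map_smul, hr, map_zero, smul_zero]
  rw [this]; exact map_zero _

theorem hasProjectiveDimensionLT_smulShortComplex {R : Type u} [CommRing R] {M : ModuleCat.{u} R}
    {r : R} (hM : IsSMulRegular M r) {n : ℕ} (h : HasProjectiveDimensionLT M n) :
    HasProjectiveDimensionLT (ModuleCat.smulShortComplex M r).X₃ (n + 1) :=
  hM.smulShortComplex_shortExact.hasProjectiveDimensionLT_X₃ n h
    (hasProjectiveDimensionLT_of_ge M n (n + 1) (by lia))

/-- If `k` embeds in a finitely generated module `Q` of projective dimension `< n`, killed by a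
power of the maximal ideal, over a local ring of finite injective dimension, then
`Ext^i(-, L)` vanishes for `i ≥ n` on the finitely generated modules killed by a power of the
maximal ideal. -/
theorem ext_eq_zero_of_finite_of_pow_smul {L : Type u} [CommRing L] [IsLocalRing L]
    [IsNoetherianRing L] {d n : ℕ} (hL : HasInjectiveDimensionLT (ModuleCat.of L L) d)
    {Q : Type u} [AddCommGroup Q] [Module L Q] [Module.Finite L Q]
    (hQ : HasProjectiveDimensionLT (ModuleCat.of L Q) n)
    {r : ℕ} (hr : ∀ a ∈ IsLocalRing.maximalIdeal L ^ r, ∀ q : Q, a • q = 0)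
    {z : Q} (hz : z ≠ 0) (hzm : ∀ a ∈ IsLocalRing.maximalIdeal L, a • z = 0)
    (i : ℕ) (hi : n ≤ i) (N : Type u) [AddCommGroup N] [Module L N] (hN : Module.Finite L N)
    (hrN : ∃ r, ∀ a ∈ IsLocalRing.maximalIdeal L ^ r, ∀ q : N, a • q = 0) 
    (x : Abelian.Ext (ModuleCat.of L N) (ModuleCat.of L L) i) : x = 0 := by
  obtain ⟨e, he⟩ : ∃ e, d ≤ i + e := ⟨d, by lia⟩
  induction e generalizing i N with
  | zero => exact Abelian.Ext.eq_zero_of_hasInjectiveDimensionLT _ d he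
  | succ e ih =>
    revert x
    refine IsNoetherianRing.induction_on_isQuotientEquivQuotientPrime L hN
      (motive := fun N _ _ _ => (∃ r, ∀ a ∈ IsLocalRing.maximalIdeal L ^ r, ∀ q : N, a • q = 0) →
        ∀ x : Abelian.Ext (ModuleCat.of L N) (ModuleCat.of L L) i, x = 0) ?_ ?_ ?_ hrN
    · intro N _ _ _ _ _ x
      have := (ModuleCat.isZero_of_subsingleton (ModuleCat.of L N)).hasProjectiveDimensionLT_zero
      exact Abelian.Ext.eq_zero_of_hasProjectiveDimensionLT x 0 (Nat.zero_le _)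
    · intro N _ _ _ p e ⟨s, hs⟩ x
      have hp : IsLocalRing.maximalIdeal L ^ s ≤ p.1 := fun a ha => by
        have h1 := hs a ha (e.symm (Ideal.Quotient.mk _ 1))
        rw [← map_smul, e.symm.map_eq_zero_iff] at h1
        rw [← Ideal.Quotient.eq_zero_iff_mem, ← h1, Algebra.smul_def, map_one, mul_one]
        rfl
      have hpm : p.1 = IsLocalRing.maximalIdeal L :=
        le_antisymm (IsLocalRing.le_maximalIdeal p.2.ne_top) (p.2.le_of_pow_le hp)
      let j₀ : (L ⧸ p.1) →ₗ[L] Q := Submodule.liftQ p.1 (LinearMap.toSpanSingleton L Q z)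
        fun a ha => hzm a (hpm ▸ ha)
      have hj₀ : Function.Injective j₀ := by
        rw [← LinearMap.ker_eq_bot]
        refine Submodule.ker_liftQ_eq_bot _ _ _ fun a ha => ?_
        rw [hpm]
        by_contra hu
        have hu : IsUnit a := by simpa using hu
        exact hz (hu.smul_eq_zero.1 ha)
      let j : N →ₗ[L] Q := j₀ ∘ₗ e.toLinearMap
      have hj : Function.Injective j := hj₀.comp e.injective
      have hjg : Function.Exact j (LinearMap.range j).mkQ := LinearMap.exact_map_mkQ_range j
      have hS := ModuleCat.shortComplex_shortExact
        (ModuleCat.shortComplexOfCompEqZero j _ hjg.linearMap_comp_eq_zero) hjg hj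
        (Submodule.mkQ_surjective _)
      obtain ⟨y, hy⟩ := Abelian.Ext.contravariant_sequence_exact₁ hS (ModuleCat.of L L) x
        (add_comm 1 i) (ih (i + 1) (by lia) (Q ⧸ LinearMap.range j) inferInstance
          ⟨r, fun a ha q => by
            obtain ⟨q, rfl⟩ := Submodule.mkQ_surjective _ q
            rw [← map_smul, hr a ha, map_zero]⟩ _ (by lia))
      have hy0 : y = 0 := Abelian.Ext.eq_zero_of_hasProjectiveDimensionLT y n hi
      rw [← hy, hy0, Abelian.Ext.comp_zero]
    · intro N₁ _ _ _ N₂ _ _ _ N₃ _ _ _ f g hf hg hfg h₁ h₃ ⟨r, hr⟩ x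
      have h₁ := h₁ ⟨r, fun a ha q => hf (by rw [map_smul, hr a ha, map_zero])⟩
      have h₃ := h₃ ⟨r, fun a ha q => by
        obtain ⟨q, rfl⟩ := hg q
        rw [← map_smul, hr a ha, map_zero]⟩
      have hS := ModuleCat.shortComplex_shortExact
        (ModuleCat.shortComplexOfCompEqZero f g hfg.linearMap_comp_eq_zero) hfg hf hg
      obtain ⟨y, hy⟩ := Abelian.Ext.contravariant_sequence_exact₂ hS (ModuleCat.of L L) x (h₁ _)
      rw [← hy, h₃ y, Abelian.Ext.comp_zero]

/-- In a local Noetherian ring of finite self-injective dimension, the socle of the quotient by a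
regular sequence of length three that is primary to the maximal ideal is at most
one-dimensional. -/
theorem exists_smul_eq_of_hasInjectiveDimensionLT {L : Type u} [CommRing L] [IsLocalRing L]
    [IsNoetherianRing L] {d : ℕ} (hL : HasInjectiveDimensionLT (ModuleCat.of L L) d)
    {a b c : L} (ha : IsSMulRegular (ModuleCat.of L L) a)
    (hb : IsSMulRegular (ModuleCat.smulShortComplex (ModuleCat.of L L) a).X₃ b)
    (hc : IsSMulRegular
      (ModuleCat.smulShortComplex (ModuleCat.smulShortComplex (ModuleCat.of L L) a).X₃ b).X₃ c)
    (hal : a ∈ IsLocalRing.maximalIdeal L) (hbl : b ∈ IsLocalRing.maximalIdeal L)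
    (hcl : c ∈ IsLocalRing.maximalIdeal L)
    (Q : ModuleCat.{u} L) (hQ : Q = (ModuleCat.smulShortComplex (ModuleCat.smulShortComplex
      (ModuleCat.smulShortComplex (ModuleCat.of L L) a).X₃ b).X₃ c).X₃)
    (haQ : ∀ q : Q, a • q = 0) (hbQ : ∀ q : Q, b • q = 0) (hcQ : ∀ q : Q, c • q = 0)
    (w : Q) (hw : ∀ q : Q, ∃ l : L, q = l • w)
    {r : ℕ} (hr : ∀ a ∈ IsLocalRing.maximalIdeal L ^ r, ∀ q : Q, a • q = 0)
    {z₁ z₂ : Q} (hz₁ : z₁ ≠ 0) (hz₁m : ∀ a ∈ IsLocalRing.maximalIdeal L, a • z₁ = 0)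
    (hz₂m : ∀ a ∈ IsLocalRing.maximalIdeal L, a • z₂ = 0) :
    ∃ g : L, z₂ = g • z₁ := by
  have hfin : Module.Finite L Q := ⟨⟨{w}, by
    rw [eq_top_iff]
    rintro q -
    obtain ⟨l, rfl⟩ := hw q
    exact Submodule.smul_mem _ _ (Submodule.subset_span (by simp))⟩⟩
  have hQpd : HasProjectiveDimensionLT Q 4 := by
    rw [hQ]
    exact hasProjectiveDimensionLT_smulShortComplex hc
      (hasProjectiveDimensionLT_smulShortComplex hb
        (hasProjectiveDimensionLT_smulShortComplex ha
          (projective_iff_hasProjectiveDimensionLT_one.1 inferInstance)))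
  let k := ModuleCat.of L (L ⧸ IsLocalRing.maximalIdeal L)
  have hk : ∀ l ∈ IsLocalRing.maximalIdeal L, ∀ q : k, l • q = 0 := fun l hl q => by
    obtain ⟨q, rfl⟩ := Submodule.mkQ_surjective _ q
    rw [← map_smul]
    exact (Submodule.Quotient.mk_eq_zero _).2 (Ideal.mul_mem_right _ _ hl)
  let J (z : Q) (hz : ∀ a ∈ IsLocalRing.maximalIdeal L, a • z = 0) : k →ₗ[L] Q :=
    Submodule.liftQ (IsLocalRing.maximalIdeal L) (LinearMap.toSpanSingleton L Q z) hz
  have hJ1 : ∀ z hz, J z hz (Submodule.mkQ _ 1) = z := fun z hz => by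
    refine (Submodule.liftQ_apply _ _ _).trans ?_
    simp
  have hj : Function.Injective (J z₁ hz₁m) := by
    rw [← LinearMap.ker_eq_bot]
    refine Submodule.ker_liftQ_eq_bot _ _ _ fun a ha => ?_
    by_contra hu
    have hu : IsUnit a := by simpa using hu
    exact hz₁ (hu.smul_eq_zero.1 ha)
  have hjg := LinearMap.exact_map_mkQ_range (J z₁ hz₁m)
  have hS := ModuleCat.shortComplex_shortExact
    (ModuleCat.shortComplexOfCompEqZero (J z₁ hz₁m) _ hjg.linearMap_comp_eq_zero) hjg hj
    (Submodule.mkQ_surjective _)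
  let Φ (N : ModuleCat.{u} L) (f : N ⟶ Q) : Abelian.Ext N (ModuleCat.of L L) 3 :=
    ((((Abelian.Ext.mk₀ (f ≫ eqToHom hQ)).comp (smulExtClass hc)
      (zero_add 1)).comp (smulExtClass hb) (one_add_one_eq_two)).comp
        (smulExtClass ha) (two_add_one_eq_three))
  have hΦs : Function.Surjective (Φ Q) := fun x => by
    obtain ⟨x₂, rfl⟩ := exists_comp_extClass_smulShortComplex ha haQ two_add_one_eq_three x
    obtain ⟨x₁, rfl⟩ := exists_comp_extClass_smulShortComplex hb hbQ one_add_one_eq_two x₂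
    obtain ⟨x₀, rfl⟩ := exists_comp_extClass_smulShortComplex hc hcQ (zero_add 1) x₁
    obtain ⟨f, rfl⟩ := Abelian.Ext.addEquiv₀.symm.surjective x₀
    refine ⟨f ≫ eqToHom hQ.symm, ?_⟩
    simp only [Φ, Category.assoc, eqToHom_trans, eqToHom_refl, Category.comp_id]
    rfl
  have hΦi : ∀ f g : k ⟶ Q, Φ k f = Φ k g → f = g := fun f g hfg => by
    have h0 := ext_zero_eq_zero hc (hk c hcl)
    have h1 := ext_succ_eq_zero hb (hk b hbl) (zero_add 1) h0
    have h2 := ext_succ_eq_zero ha (hk a hal) one_add_one_eq_two h1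
    have h3 : Φ k (f - g) = 0 := by
      have h3 : Φ k f = Φ k (f - g) + Φ k g := by
        simp only [Φ, ← Abelian.Ext.add_comp, ← Abelian.Ext.mk₀_add, ← Preadditive.add_comp,
          sub_add_cancel]
      rwa [hfg, right_eq_add] at h3
    have h4 := eq_zero_of_comp_extClass hc (zero_add 1) h0 _
      (eq_zero_of_comp_extClass hb one_add_one_eq_two h1 _
        (eq_zero_of_comp_extClass ha two_add_one_eq_three h2 _ h3))
    have h5 := Abelian.Ext.addEquiv₀.symm.injective (h4.trans (map_zero _).symm)
    rw [← cancel_mono (eqToHom hQ), ← sub_eq_zero, ← Preadditive.sub_comp, h5]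
  obtain ⟨y, hy⟩ := Abelian.Ext.contravariant_sequence_exact₁ hS (ModuleCat.of L L)
    (Φ k (ModuleCat.ofHom (J z₂ hz₂m))) (show 1 + 3 = 4 by norm_num)
    (ext_eq_zero_of_finite_of_pow_smul hL hQpd hr hz₁ hz₁m 4 le_rfl
      (Q ⧸ LinearMap.range (J z₁ hz₁m)) inferInstance
      ⟨r, fun a ha q => by
        obtain ⟨q, rfl⟩ := Submodule.mkQ_surjective _ q
        rw [← map_smul, hr a ha, map_zero]⟩ _)
  obtain ⟨g, rfl⟩ := hΦs y
  have hg : ModuleCat.ofHom (J z₁ hz₁m) ≫ g = ModuleCat.ofHom (J z₂ hz₂m) := by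
    refine hΦi _ _ (Eq.trans ?_ hy)
    simp only [Φ, Category.assoc]
    rw [← Abelian.Ext.mk₀_comp_mk₀]
    have key {X Y Z T : ModuleCat.{u} L} {n m : ℕ} (α : Abelian.Ext X Y 0)
        (β : Abelian.Ext Y Z n) (γ : Abelian.Ext Z T 1) (h : n + 1 = m) :
        (α.comp β (zero_add n)).comp γ h = α.comp (β.comp γ h) (zero_add m) := by
      apply Abelian.Ext.comp_assoc; lia
    exact ((congrArg (fun t => (Abelian.Ext.comp t (smulExtClass hb) one_add_one_eq_two).comp
      (smulExtClass ha) two_add_one_eq_three) (key _ _ _ (zero_add 1))).trans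
        (congrArg (fun t => Abelian.Ext.comp t (smulExtClass ha) two_add_one_eq_three)
          (key _ _ _ one_add_one_eq_two))).trans (key _ _ _ two_add_one_eq_three)
  have hg1 : g.hom z₁ = z₂ := by
    have := congrArg (fun f : k ⟶ Q => f.hom (Submodule.mkQ _ 1)) hg
    rw [← hJ1 z₁ hz₁m, ← hJ1 z₂ hz₂m]
    exact this
  obtain ⟨t, ht⟩ := hw (g.hom w)
  obtain ⟨l, hl⟩ := hw z₁
  exact ⟨t, by rw [← hg1, hl, map_smul, ht, smul_comm]⟩

end

section
open Pointwise

theorem isSMulRegular_of_ker_eq {L M : Type*} [CommRing L] [AddCommGroup M] [Module L M]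
    {π : L →ₗ[L] M} (hπ : Function.Surjective π) {I : Ideal L} (hI : LinearMap.ker π = I) {r : L}
    (h : ∀ x, r * x ∈ I → x ∈ I) : IsSMulRegular M r := by
  refine IsSMulRegular.of_right_eq_zero_of_smul fun m hm => ?_
  obtain ⟨x, rfl⟩ := hπ m
  subst hI
  exact h x (by rwa [LinearMap.mem_ker, ← smul_eq_mul, map_smul])

theorem exists_surjective_smulShortComplex {L : Type u} [CommRing L] {M : ModuleCat.{u} L}
    {π : L →ₗ[L] M} (hπ : Function.Surjective π) {I : Ideal L} (hI : LinearMap.ker π = I) (r : L) :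
    ∃ π' : L →ₗ[L] (ModuleCat.smulShortComplex M r).X₃, Function.Surjective π' ∧
      LinearMap.ker π' = I ⊔ Ideal.span {r} := by
  let q : M →ₗ[L] (ModuleCat.smulShortComplex M r).X₃ := Submodule.mkQ (r • (⊤ : Submodule L M))
  have hq : LinearMap.ker q = r • (⊤ : Submodule L M) := Submodule.ker_mkQ _
  have hqs : Function.Surjective q := Submodule.mkQ_surjective _
  refine ⟨q ∘ₗ π, hqs.comp hπ, ?_⟩
  ext x
  rw [LinearMap.ker_comp, hq, Submodule.mem_comap, Submodule.mem_smul_pointwise_iff_exists,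
    Submodule.mem_sup]
  constructor
  · rintro ⟨m, -, hm⟩
    obtain ⟨y, rfl⟩ := hπ m
    refine ⟨x - r * y, ?_, r * y, Ideal.mul_mem_right _ _ (Ideal.mem_span_singleton_self r), by ring⟩
    rw [← hI, LinearMap.mem_ker, map_sub, ← smul_eq_mul, map_smul, hm, sub_self]
  · rintro ⟨y, hy, z, hz, rfl⟩
    obtain ⟨z, rfl⟩ := Ideal.mem_span_singleton.1 hz
    refine ⟨π z, trivial, ?_⟩
    rw [← hI, LinearMap.mem_ker] at hy
    rw [map_add, hy, zero_add, ← smul_eq_mul, map_smul]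

theorem exists_sub_mul_mem_of_hasInjectiveDimensionLT {L : Type u} [CommRing L] [IsLocalRing L]
    [IsNoetherianRing L] {d : ℕ} (hL : HasInjectiveDimensionLT (ModuleCat.of L L) d)
    {a b c : L} {I₀ I₁ I₂ I₃ : Ideal L} (h₀ : I₀ = ⊥) (h₁ : I₁ = I₀ ⊔ Ideal.span {a})
    (h₂ : I₂ = I₁ ⊔ Ideal.span {b}) (h₃ : I₃ = I₂ ⊔ Ideal.span {c})
    (ha : ∀ x, a * x ∈ I₀ → x ∈ I₀) (hb : ∀ x, b * x ∈ I₁ → x ∈ I₁)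
    (hc : ∀ x, c * x ∈ I₂ → x ∈ I₂) (hI : I₃ ≤ IsLocalRing.maximalIdeal L)
    {r : ℕ} (hr : IsLocalRing.maximalIdeal L ^ r ≤ I₃)
    {s₁ s₂ : L} (hs : s₁ ∉ I₃) (hs₁ : ∀ x ∈ IsLocalRing.maximalIdeal L, x * s₁ ∈ I₃)
    (hs₂ : ∀ x ∈ IsLocalRing.maximalIdeal L, x * s₂ ∈ I₃) :
    ∃ g, s₂ - g * s₁ ∈ I₃ := by
  have hπ₀ : LinearMap.ker (LinearMap.id : L →ₗ[L] ModuleCat.of L L) = I₀ := by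
    rw [h₀]; exact LinearMap.ker_id
  have hs₀ : Function.Surjective (LinearMap.id : L →ₗ[L] ModuleCat.of L L) := fun x => ⟨x, rfl⟩
  obtain ⟨π₁, hs₁', hπ₁⟩ := exists_surjective_smulShortComplex
    (M := ModuleCat.of L L) hs₀ hπ₀ a
  obtain ⟨π₂, hs₂', hπ₂⟩ := exists_surjective_smulShortComplex hs₁' (hπ₁.trans h₁.symm) b
  obtain ⟨π₃, hs₃', hπ₃⟩ := exists_surjective_smulShortComplex hs₂' (hπ₂.trans h₂.symm) c
  have hker : ∀ x, π₃ x = 0 ↔ x ∈ I₃ := fun x => by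
    rw [h₃, ← hπ₃, LinearMap.mem_ker]
  have hkill : ∀ x ∈ I₃, ∀ q : (ModuleCat.smulShortComplex (ModuleCat.smulShortComplex
      (ModuleCat.smulShortComplex (ModuleCat.of L L) a).X₃ b).X₃ c).X₃, x • q = 0 := fun x hx q => by
    obtain ⟨q, rfl⟩ := hs₃' q
    rw [← map_smul, hker]
    exact Ideal.mul_mem_right _ _ hx
  have haI : a ∈ I₃ := by
    rw [h₃, h₂, h₁]
    exact Ideal.mem_sup_left (Ideal.mem_sup_left (Ideal.mem_sup_right <| Ideal.mem_span_singleton_self a))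
  have hbI : b ∈ I₃ := by
    rw [h₃, h₂]
    exact Ideal.mem_sup_left (Ideal.mem_sup_right <| Ideal.mem_span_singleton_self b)
  have hcI : c ∈ I₃ := by
    rw [h₃]
    exact Ideal.mem_sup_right (Ideal.mem_span_singleton_self c)
  obtain ⟨g, hg⟩ := exists_smul_eq_of_hasInjectiveDimensionLT hL
    (isSMulRegular_of_ker_eq hs₀ hπ₀ ha) (isSMulRegular_of_ker_eq hs₁' (hπ₁.trans h₁.symm) hb)
    (isSMulRegular_of_ker_eq hs₂' (hπ₂.trans h₂.symm) hc) (hI haI) (hI hbI) (hI hcI) _ rfl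
    (hkill a haI) (hkill b hbI) (hkill c hcI) (π₃ 1)
    (fun q => by
      obtain ⟨q, rfl⟩ := hs₃' q
      exact ⟨q, by rw [← map_smul, smul_eq_mul, mul_one]⟩)
    (fun x hx q => hkill x (hr hx) q) (z₁ := π₃ s₁) (z₂ := π₃ s₂)
    (fun h => hs ((hker _).1 h))
    (fun x hx => by rw [← map_smul, hker]; exact hs₁ x hx)
    (fun x hx => by rw [← map_smul, hker]; exact hs₂ x hx)
  exact ⟨g, by rw [← hker, map_sub, hg, ← smul_eq_mul, map_smul, sub_self]⟩

theorem mem_map_of_mul_mem_map {R L : Type*} [CommRing R] [CommRing L] [Algebra R L]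
    (S : Submonoid R) [IsLocalization S L] {I : Ideal R} {a : R} (h : ∀ x, a * x ∈ I → x ∈ I)
    (y : L) (hy : algebraMap R L a * y ∈ I.map (algebraMap R L)) : y ∈ I.map (algebraMap R L) := by
  obtain ⟨x, s, rfl⟩ := IsLocalization.exists_mk'_eq S y
  rw [IsLocalization.mk'_mem_map_algebraMap_iff]
  rw [IsLocalization.mul_mk'_eq_mk'_of_mul, IsLocalization.mk'_mem_map_algebraMap_iff] at hy
  obtain ⟨t, ht, htx⟩ := hy
  exact ⟨t, ht, h _ (by rwa [mul_left_comm])⟩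

theorem IsGorensteinRing.exists_sub_mul_mem {R : Type u} [CommRing R] (hR : IsGorensteinRing R)
    (m : Ideal R) [hm : m.IsMaximal] {a b c : R}
    (ha : ∀ x, a * x = 0 → x = 0) (hb : ∀ x, b * x ∈ Ideal.span {a} → x ∈ Ideal.span {a})
    (hc : ∀ x, c * x ∈ Ideal.span {a, b} → x ∈ Ideal.span {a, b})
    (ham : a ∈ m) (hbm : b ∈ m) (hcm : c ∈ m) (hrad : m ≤ (Ideal.span {a, b, c}).radical)
    {s₁ s₂ : R} (hs : s₁ ∉ Ideal.span {a, b, c})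
    (hs₁ : ∀ x ∈ m, x * s₁ ∈ Ideal.span {a, b, c})
    (hs₂ : ∀ x ∈ m, x * s₂ ∈ Ideal.span {a, b, c}) :
    ∃ g, s₂ - g * s₁ ∈ Ideal.span {a, b, c} := by
  have hnoeth := hR.1
  obtain ⟨d, hd⟩ := (hasFiniteInjectiveDimension_iff _ _).1 (hR.2 m)
  let f := algebraMap R (Localization.AtPrime m)
  have hf : IsLocalRing.maximalIdeal (Localization.AtPrime m) = m.map f :=
    (Localization.AtPrime.map_eq_maximalIdeal).symm
  obtain ⟨r, hr⟩ := Ideal.exists_pow_le_of_le_radical_of_fg hrad (IsNoetherian.noetherian m)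
  have key : ∀ s, (∀ x ∈ m, x * s ∈ Ideal.span {a, b, c}) →
      ∀ x ∈ IsLocalRing.maximalIdeal (Localization.AtPrime m),
        x * f s ∈ (Ideal.span {a, b, c}).map f := fun s h x hx => by
    rw [hf] at hx
    have h1 : (m * Ideal.span {s}).map f ≤ (Ideal.span {a, b, c}).map f :=
      Ideal.map_mono (Ideal.mul_le.2 fun y hy z hz => by
        obtain ⟨z, rfl⟩ := Ideal.mem_span_singleton.1 hz
        rw [← mul_assoc]
        exact Ideal.mul_mem_right _ _ (h y hy))
    rw [Ideal.map_mul] at h1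
    exact h1 (Ideal.mul_mem_mul hx (Ideal.mem_map_of_mem _ (Ideal.mem_span_singleton_self s)))
  have key2 : ∀ s, (∀ x ∈ m, x * s ∈ Ideal.span {a, b, c}) → ∀ t ∉ m,
      t * s ∈ Ideal.span {a, b, c} → s ∈ Ideal.span {a, b, c} := fun s h t ht hts => by
    obtain ⟨y, x, hx, hxy⟩ := hm.exists_inv ht
    have : s = y * (t * s) + x * s := by rw [← mul_assoc, ← add_mul, hxy, one_mul]
    rw [this]
    exact add_mem (Ideal.mul_mem_left _ _ hts) (h x hx)
  obtain ⟨g, hg⟩ := exists_sub_mul_mem_of_hasInjectiveDimensionLT hd (a := f a) (b := f b)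
    (c := f c) (I₀ := (⊥ : Ideal R).map f) (I₁ := (Ideal.span {a}).map f)
    (I₂ := (Ideal.span {a, b}).map f) (I₃ := (Ideal.span {a, b, c}).map f) (s₁ := f s₁)
    (s₂ := f s₂) (r := r) (Ideal.map_bot) (by simp [Ideal.map_span])
    (by simp [Ideal.map_span, Set.image_insert_eq, ← Ideal.span_union]
        rw [Set.pair_comm])
    (by simp only [Ideal.map_span, Set.image_insert_eq, Set.image_singleton, ← Ideal.span_union]
        congr 1; ext; simp; tauto)
    (mem_map_of_mul_mem_map m.primeCompl (by simpa using ha))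
    (mem_map_of_mul_mem_map m.primeCompl hb) (mem_map_of_mul_mem_map m.primeCompl hc)
    (by rw [hf]; exact Ideal.map_mono (Ideal.span_le.2 (by simp [Set.insert_subset_iff, *])))
    (by rw [hf, ← Ideal.map_pow]; exact Ideal.map_mono hr)
    (fun h => by
      obtain ⟨t, ht, hts⟩ := (IsLocalization.algebraMap_mem_map_algebraMap_iff m.primeCompl _ _ _).1 h
      exact hs (key2 s₁ hs₁ t ht hts))
    (key s₁ hs₁) (key s₂ hs₂)
  obtain ⟨γ, t, rfl⟩ := IsLocalization.exists_mk'_eq m.primeCompl g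
  have h1 : f (t * s₂ - γ * s₁) ∈ (Ideal.span {a, b, c}).map f := by
    have := Ideal.mul_mem_left _ (f t) hg
    rwa [mul_sub, ← mul_assoc, mul_comm (f t) (IsLocalization.mk' _ _ _),
      IsLocalization.mk'_spec, ← map_mul, ← map_mul, ← map_sub] at this
  obtain ⟨t', ht', h2⟩ :=
    (IsLocalization.algebraMap_mem_map_algebraMap_iff m.primeCompl _ _ _).1 h1
  have h3 := key2 (t * s₂ - γ * s₁) (fun x hx => by
    rw [mul_sub, mul_left_comm x, mul_left_comm x]
    exact sub_mem (Ideal.mul_mem_left _ _ (hs₂ x hx)) (Ideal.mul_mem_left _ _ (hs₁ x hx))) t' ht' h2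
  obtain ⟨y, x, hx, hxy⟩ := hm.exists_inv t.2
  refine ⟨y * γ, ?_⟩
  have : s₂ - y * γ * s₁ = y * (t * s₂ - γ * s₁) + x * s₂ := by
    linear_combination (-s₂) * hxy
  rw [this]
  exact add_mem (Ideal.mul_mem_left _ _ h3) (hs₂ x hx)

end

theorem hasInjectiveDimensionLE_of_ringEquiv {B L : Type u} [CommRing B] [CommRing L]
    (e : B ≃+* L) {d : ℕ} (h : HasInjectiveDimensionLE (ModuleCat.of B B) d) :
    HasInjectiveDimensionLE (ModuleCat.of L L) d := by
  let _ : Algebra B L := e.toRingHom.toAlgebra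
  have he : ∀ b : B, algebraMap B L b = e b := fun _ => rfl
  let l : B ≃ₗ[B] L :=
    { e with map_smul' := fun b x => by simp [Algebra.smul_def, he] }
  have : Module.Projective B L := Module.Projective.of_equiv l
  refine hasInjectiveDimensionLE_of_coinduced (B := B) (M := B) (e.symm : L →+ B) ?_ ?_ ?_ d h
  · intro b x
    simp [he]
  · intro x hx
    simpa using hx 1
  · intro ψ
    refine ⟨e (ψ 1), fun r => ?_⟩
    have := ψ.map_smul (e.symm r) 1
    simpa [Algebra.smul_def, he, mul_comm] using this.symm

theorem IsGorensteinRing.of_ringEquiv {R S : Type u} [CommRing R] [CommRing S] (e : R ≃+* S)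
    (h : IsGorensteinRing R) : IsGorensteinRing S := by
  have := h.1
  refine ⟨isNoetherianRing_of_ringEquiv R e, fun P hP => (hasFiniteInjectiveDimension_iff _ _).2 ?_⟩
  obtain ⟨d, hd⟩ := (hasFiniteInjectiveDimension_iff _ _).1 (h.2 (P.comap (e : R →+* S)))
  exact ⟨d, hasInjectiveDimensionLE_of_ringEquiv
    (IsLocalization.ringEquivOfRingEquiv (Localization.AtPrime (P.comap (e : R →+* S)))
      (Localization.AtPrime P) e (M := (P.comap (e : R →+* S)).primeCompl) (T := P.primeCompl)
      (by
        ext x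
        constructor
        · rintro ⟨y, hy, rfl⟩
          exact hy
        · intro hx
          refine ⟨e.symm x, ?_, by simp⟩
          intro h
          exact hx (by simpa using h))) hd⟩

/-- The weight `-m₀ + 5 m₁ + 6 m₂` of an exponent vector. -/
def expWeight : (Fin 3 →₀ ℕ) →+ ℤ where
  toFun m := -(m 0 : ℤ) + 5 * m 1 + 6 * m 2
  map_zero' := by simp
  map_add' a b := by simp; ring

theorem expWeight_apply (m : Fin 3 →₀ ℕ) : expWeight m = -(m 0 : ℤ) + 5 * m 1 + 6 * m 2 := rfl

/-- The polynomials all of whose monomials have weight divisible by `n`. -/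
def weightRing (F : Type u) [CommSemiring F] (n : ℕ) : Subalgebra F (MvPolynomial (Fin 3) F) where
  carrier := {P | ∀ m ∈ P.support, (n : ℤ) ∣ expWeight m}
  mul_mem' := fun {P Q} hP hQ m hm => by
    classical
    obtain ⟨a, ha, b, hb, rfl⟩ := Finset.mem_add.1 (support_mul P Q hm)
    rw [map_add]
    exact dvd_add (hP a ha) (hQ b hb)
  add_mem' := fun {P Q} hP hQ m hm => by
    classical
    rcases Finset.mem_union.1 (support_add hm) with h | h
    exacts [hP m h, hQ m h]
  algebraMap_mem' := fun r m hm => by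
    classical
    rw [algebraMap_eq, mem_support_iff, coeff_C] at hm
    have : m = 0 := by
      by_contra h
      exact hm (if_neg (Ne.symm h))
    simp [this]

theorem monomial_mem_weightRing {F : Type u} [CommSemiring F] {n : ℕ} {m : Fin 3 →₀ ℕ} (a : F)
    (hm : (n : ℤ) ∣ expWeight m) : monomial m a ∈ weightRing F n := fun k hk => by
  classical
  rw [mem_support_iff, coeff_monomial] at hk
  have : m = k := by
    by_contra h
    exact hk (if_neg h)
  rwa [← this]

theorem mem_of_forall_monomial {F : Type u} [CommSemiring F] {n : ℕ} (I : Ideal (weightRing F n))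
    (P : weightRing F n) (h : ∀ m ∈ (P : MvPolynomial (Fin 3) F).support, ∀ (a : F)
      (hm : (n : ℤ) ∣ expWeight m), (⟨monomial m a, monomial_mem_weightRing a hm⟩ : weightRing F n) ∈ I) :
    P ∈ I := by
  have : P = ∑ m ∈ (P : MvPolynomial (Fin 3) F).support.attach,
      (⟨monomial m.1 (coeff m.1 P.1), monomial_mem_weightRing _ (P.2 m m.2)⟩ : weightRing F n) := by
    apply Subtype.ext
    rw [AddSubmonoidClass.coe_finsetSum, Finset.sum_attach _ (fun m => monomial m (coeff m P.1))]
    exact P.1.as_sum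
  rw [this]
  exact sum_mem fun m _ => h m m.2 _ (P.2 m m.2)

theorem dvd_expWeight_single (n : ℕ) (i : Fin 3) : (n : ℤ) ∣ expWeight (Finsupp.single i n) := by
  rw [expWeight_apply]
  fin_cases i <;> simp

/-- The element `X i ^ n` of the weight ring. -/
def weightPow (F : Type u) [CommSemiring F] (n : ℕ) (i : Fin 3) : weightRing F n :=
  ⟨monomial (Finsupp.single i n) 1, monomial_mem_weightRing 1 (dvd_expWeight_single n i)⟩

theorem mem_span_weightPow_iff {F : Type u} [CommSemiring F] {n : ℕ} (I : Set (Fin 3))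
    (P : weightRing F n) : P ∈ Ideal.span (weightPow F n '' I) ↔
      ∀ m ∈ (P : MvPolynomial (Fin 3) F).support, ∃ i ∈ I, n ≤ m i := by
  constructor
  · intro h m hm
    have h1 := Ideal.mem_map_of_mem (weightRing F n).val.toRingHom h
    rw [Ideal.map_span, ← Set.image_comp] at h1
    have h2 : (P : MvPolynomial (Fin 3) F) ∈ Ideal.span ((fun s => monomial s (1 : F)) ''
        ((fun i => Finsupp.single i n) '' I)) := by
      rw [← Set.image_comp]
      exact h1
    obtain ⟨_, ⟨i, hi, rfl⟩, him⟩ := mem_ideal_span_monomial_image.1 h2 m hm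
    exact ⟨i, hi, by simpa using him i⟩
  · intro h
    refine mem_of_forall_monomial _ _ fun m hm a hma => ?_
    obtain ⟨i, hi, him⟩ := h m hm
    have h1 : m = Finsupp.single i n + (m - Finsupp.single i n) :=
      (add_tsub_cancel_of_le (Finsupp.single_le_iff.2 him)).symm
    have h2 : (n : ℤ) ∣ expWeight (m - Finsupp.single i n) := by
      rw [h1, map_add] at hma
      exact (dvd_add_right (dvd_expWeight_single n i)).1 hma
    have h3 : (⟨monomial m a, monomial_mem_weightRing a hma⟩ : weightRing F n) =
        weightPow F n i * ⟨monomial (m - Finsupp.single i n) a, monomial_mem_weightRing a h2⟩ := by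
      apply Subtype.ext
      change monomial m a = monomial _ 1 * monomial _ a
      rw [monomial_mul, ← h1, one_mul]
    rw [h3]
    exact Ideal.mul_mem_right _ _ (Ideal.subset_span ⟨i, hi, rfl⟩)

theorem mem_span_of_weightPow_mul_mem {F : Type u} [CommSemiring F] {n : ℕ} {I : Set (Fin 3)}
    {i : Fin 3} (hi : i ∉ I) (P : weightRing F n)
    (h : weightPow F n i * P ∈ Ideal.span (weightPow F n '' I)) :
    P ∈ Ideal.span (weightPow F n '' I) := by
  rw [mem_span_weightPow_iff] at h ⊢
  intro m hm
  obtain ⟨j, hj, hjm⟩ := h (Finsupp.single i n + m) (by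
    rw [mem_support_iff] at hm ⊢
    change coeff _ (monomial _ 1 * P.1) ≠ 0
    rwa [coeff_monomial_mul, one_mul])
  have hij : i ≠ j := fun h => hi (h ▸ hj)
  exact ⟨j, hj, by simpa [Finsupp.single_apply, hij] using hjm⟩

/-- The exponent vector with the given entries. -/
def expVec (i j k : ℕ) : Fin 3 →₀ ℕ := Finsupp.equivFunOnFinite.symm ![i, j, k]

@[simp] theorem expVec_zero (i j k : ℕ) : expVec i j k 0 = i := rfl
@[simp] theorem expVec_one (i j k : ℕ) : expVec i j k 1 = j := rfl
@[simp] theorem expVec_two (i j k : ℕ) : expVec i j k 2 = k := rfl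

theorem dvd_ten_of_isGorensteinRing {F : Type u} [Field F] {n : ℕ} (hn : n ≠ 0)
    (h : IsGorensteinRing (weightRing F n)) : n ∣ 10 := by
  classical
  by_contra h10
  have h1 : n ≠ 1 := by rintro rfl; simp at h10
  let ε : weightRing F n →+* F := (constantCoeff (R := F) (σ := Fin 3)).comp (weightRing F n).val.toRingHom
  have hε : ∀ P, ε P = coeff 0 P.1 := fun P => rfl
  have hεs : Function.Surjective ε := fun a => ⟨algebraMap F _ a, by
    change constantCoeff (C a) = a
    simp⟩
  have hmax := RingHom.ker_isMaximal_of_surjective ε hεs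
  have hset : Ideal.span {weightPow F n 0, weightPow F n 1, weightPow F n 2} =
      Ideal.span (weightPow F n '' Set.univ) := by
    congr 1
    ext x
    simp [Fin.exists_fin_succ, eq_comm]
  obtain ⟨i, hin, hi⟩ : ∃ i : ℕ, i < n ∧ (n : ℤ) ∣ i + 11 := by
    refine ⟨((-11 : ℤ) % n).toNat, ?_, ?_⟩
    · zify
      rw [Int.toNat_of_nonneg (Int.emod_nonneg _ (by simpa using hn))]
      exact Int.emod_lt_of_pos _ (by lia)
    · rw [Int.toNat_of_nonneg (Int.emod_nonneg _ (by simpa using hn))]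
      refine ⟨-((-11 : ℤ) / n), ?_⟩
      have := Int.emod_add_mul_ediv (-11) n
      linarith
  have hi' : ¬ (n : ℤ) ∣ i + 1 := fun h' => h10 (by
    have := dvd_sub hi h'
    rw [show (i : ℤ) + 11 - (i + 1) = (10 : ℕ) by push_cast; ring] at this
    exact_mod_cast this)
  obtain ⟨j, ⟨hjn, hj⟩, hjmax⟩ : ∃ j : ℕ, (j < n ∧ (n : ℤ) ∣ 5 * j - 5) ∧
      ∀ k : ℕ, (k < n ∧ (n : ℤ) ∣ 5 * k - 5) → k ≤ j := by
    have hne : ((Finset.range n).filter fun k : ℕ => (n : ℤ) ∣ 5 * k - 5).Nonempty :=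
      ⟨1, by simp; lia⟩
    exact ⟨Finset.max' _ hne, by simpa only [Finset.mem_filter, Finset.mem_range] using Finset.max'_mem _ hne,
      fun k hk => Finset.le_max' _ _
        (by simpa only [Finset.mem_filter, Finset.mem_range] using hk)⟩
  have hs₁ : (n : ℤ) ∣ expWeight (expVec i (n - 1) (n - 1)) := by
    rw [expWeight_apply]
    simp only [expVec_zero, expVec_one, expVec_two, Nat.cast_sub (Nat.one_le_iff_ne_zero.2 hn)]
    rw [show -(i : ℤ) + 5 * ((n : ℤ) - (1 : ℕ)) + 6 * ((n : ℤ) - (1 : ℕ)) = n * 11 - (i + 11) by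
      push_cast; ring]
    exact dvd_sub (Dvd.intro _ rfl) hi
  have hs₂ : (n : ℤ) ∣ expWeight (expVec (n - 1) j (n - 1)) := by
    rw [expWeight_apply]
    simp only [expVec_zero, expVec_one, expVec_two, Nat.cast_sub (Nat.one_le_iff_ne_zero.2 hn)]
    rw [show -((n : ℤ) - (1 : ℕ)) + 5 * (j : ℤ) + 6 * ((n : ℤ) - (1 : ℕ)) = n * 5 + (5 * j - 5) by
      push_cast; ring]
    exact dvd_add (Dvd.intro _ rfl) hj
  have hann : ∀ (s : Fin 3 →₀ ℕ) (hs : (n : ℤ) ∣ expWeight s),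
      (∀ m : Fin 3 →₀ ℕ, m ≠ 0 → (n : ℤ) ∣ expWeight m → ∃ i, n ≤ m i + s i) →
      ∀ x ∈ RingHom.ker ε, x * (⟨monomial s 1, monomial_mem_weightRing 1 hs⟩ : weightRing F n) ∈
        Ideal.span (weightPow F n '' Set.univ) := by
    intro s hs H x hx
    rw [mem_span_weightPow_iff]
    intro m hm
    obtain ⟨a, ha, b, hb, rfl⟩ := Finset.mem_add.1 (support_mul _ _ hm)
    have hb : b = s := by
      rw [mem_support_iff, coeff_monomial] at hb
      by_contra h'
      exact hb (if_neg (Ne.symm h'))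
    subst hb
    obtain ⟨i, hi⟩ := H a (by
      rintro rfl
      rw [mem_support_iff] at ha
      exact ha hx) (x.2 a ha)
    exact ⟨i, trivial, by simpa using hi⟩
  have hnot : ∀ s : Fin 3 →₀ ℕ, (∀ i, s i < n) → ∀ P : weightRing F n, coeff s P.1 ≠ 0 →
      P ∉ Ideal.span (weightPow F n '' Set.univ) := by
    intro s hs P hP hmem
    obtain ⟨i, -, hi⟩ := (mem_span_weightPow_iff _ _).1 hmem s (mem_support_iff.2 hP)
    exact absurd hi (not_le.2 (hs i))
  have hθ : ∀ i, weightPow F n i ∈ RingHom.ker ε := fun i => by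
    rw [RingHom.mem_ker, hε]
    change coeff 0 (monomial _ 1) = 0
    rw [coeff_monomial, if_neg]
    simpa using hn
  obtain ⟨g, hg⟩ := h.exists_sub_mul_mem (RingHom.ker ε) (a := weightPow F n 0)
    (b := weightPow F n 1) (c := weightPow F n 2)
    (s₁ := ⟨monomial (expVec i (n - 1) (n - 1)) 1, monomial_mem_weightRing 1 hs₁⟩)
    (s₂ := ⟨monomial (expVec (n - 1) j (n - 1)) 1, monomial_mem_weightRing 1 hs₂⟩)
    (fun x hx => by
      have := mem_span_of_weightPow_mul_mem (I := ∅) (i := 0) (by simp) x (by simp [hx])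
      simpa using this)
    (fun x hx => by
      have := mem_span_of_weightPow_mul_mem (I := {0}) (i := 1) (by simp) x (by simpa using hx)
      simpa using this)
    (fun x hx => by
      have := mem_span_of_weightPow_mul_mem (I := {0, 1}) (i := 2) (by simp) x
        (by simpa [Set.image_insert_eq] using hx)
      simpa [Set.image_insert_eq] using this)
    (hθ 0) (hθ 1) (hθ 2)
    (by
      rw [hset]
      intro x hx
      refine mem_of_forall_monomial _ _ fun m hm a hma => ⟨n, ?_⟩
      rw [mem_span_weightPow_iff]
      intro k hk
      have hk : n • m = k := by
        rw [mem_support_iff] at hk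
        change coeff k (monomial m a ^ n) ≠ 0 at hk
        rw [monomial_pow, coeff_monomial] at hk
        by_contra h'
        exact hk (if_neg h')
      subst hk
      have hm0 : m ≠ 0 := by
        rintro rfl
        rw [mem_support_iff] at hm
        exact hm hx
      obtain ⟨l, hl⟩ := Finsupp.ne_iff.1 hm0
      exact ⟨l, trivial, by
        simpa using Nat.le_mul_of_pos_right n (Nat.pos_of_ne_zero hl)⟩)
    (by
      rw [hset]
      refine hnot (expVec i (n - 1) (n - 1)) ?_ _
        (?_ : coeff (expVec i (n - 1) (n - 1)) (monomial _ (1 : F)) ≠ 0)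
      · intro l
        fin_cases l <;> simp <;> lia
      · simp)
    (by
      rw [hset]
      refine hann _ hs₁ fun m hm hmw => ?_
      by_contra! hlt
      have h0 := hlt 0
      have h1 := hlt 1
      have h2 := hlt 2
      simp only [expVec_zero, expVec_one, expVec_two] at h0 h1 h2
      have e1 : m 1 = 0 := by lia
      have e2 : m 2 = 0 := by lia
      rw [expWeight_apply, e1, e2] at hmw
      simp only [Nat.cast_zero, mul_zero, add_zero, dvd_neg] at hmw
      have e0 : m 0 = 0 := Nat.eq_zero_of_dvd_of_lt (by exact_mod_cast hmw) (by lia)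
      refine hm (Finsupp.ext fun l => ?_)
      fin_cases l <;> simp [e0, e1, e2])
    (by
      rw [hset]
      refine hann _ hs₂ fun m hm hmw => ?_
      by_contra! hlt
      have h0 := hlt 0
      have h1 := hlt 1
      have h2 := hlt 2
      simp only [expVec_zero, expVec_one, expVec_two] at h0 h1 h2
      have e0 : m 0 = 0 := by lia
      have e2 : m 2 = 0 := by lia
      rw [expWeight_apply, e0, e2] at hmw
      have e1 : m 1 = 0 := by
        have := hjmax (m 1 + j) ⟨h1, by
          have e : 5 * ((m 1 + j : ℕ) : ℤ) - 5 =
              (-((0 : ℕ) : ℤ) + 5 * (m 1 : ℕ) + 6 * ((0 : ℕ) : ℤ)) + (5 * j - 5) := by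
            push_cast
            ring
          rw [e]
          exact dvd_add hmw hj⟩
        lia
      refine hm (Finsupp.ext fun l => ?_)
      fin_cases l <;> simp [e0, e1, e2])
  rw [hset] at hg
  refine hnot (expVec (n - 1) j (n - 1)) ?_ _ ?_ hg
  · intro l
    fin_cases l <;> simp <;> lia
  · change coeff _ (monomial _ 1 - g.1 * monomial _ 1) ≠ 0
    rw [coeff_sub, coeff_monomial, if_pos rfl, coeff_mul_monomial']
    split_ifs with hle
    · have hc : coeff (expVec (n - 1) j (n - 1) - expVec i (n - 1) (n - 1)) g.1 = 0 := by
        by_contra hne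
        have hw := g.2 _ (mem_support_iff.2 hne)
        have hle1 := hle 1
        simp only [expVec_one] at hle1
        have : j = n - 1 := by lia
        subst this
        rw [expWeight_apply] at hw
        simp only [Finsupp.tsub_apply, expVec_zero, expVec_one, expVec_two, tsub_self,
          Nat.cast_zero, mul_zero, add_zero, dvd_neg] at hw
        apply hi'
        have h3 : ((n - 1 - i : ℕ) : ℤ) = n - (i + 1) := by lia
        rw [h3] at hw
        exact (dvd_sub_right (dvd_refl _)).1 hw
      rw [hc]
      simp
    · simp

/-- The linear map picking out the top box component of a polynomial regarded as a module over the
polynomials in the `n`-th powers of the variables. -/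
def boxTrace (F : Type u) [CommSemiring F] (n : ℕ) :
    MvPolynomial (Fin 3) F →ₗ[F] MvPolynomial (Fin 3) F :=
  (basisMonomials (Fin 3) F).constr F fun m =>
    if ∀ i, m i % n = n - 1 then monomial (expVec (m 0 / n) (m 1 / n) (m 2 / n)) 1 else 0

theorem boxTrace_monomial {F : Type u} [CommSemiring F] (n : ℕ) (m : Fin 3 →₀ ℕ) (a : F) :
    boxTrace F n (monomial m a) = if ∀ i, m i % n = n - 1 then
      monomial (expVec (m 0 / n) (m 1 / n) (m 2 / n)) a else 0 := by
  have h : monomial m a = a • basisMonomials (Fin 3) F m := by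
    rw [coe_basisMonomials, smul_monomial, smul_eq_mul, mul_one]
  rw [h, map_smul, boxTrace, Module.Basis.constr_basis]
  split_ifs
  · rw [smul_monomial, smul_eq_mul, mul_one]
  · rw [smul_zero]

theorem boxTrace_expand_mul {F : Type u} [CommSemiring F] {n : ℕ} (hn : n ≠ 0)
    (b P : MvPolynomial (Fin 3) F) : boxTrace F n (expand n b * P) = b * boxTrace F n P := by
  induction b using MvPolynomial.induction_on' with
  | add p q hp hq => simp only [map_add, add_mul, hp, hq]
  | monomial k c =>
    induction P using MvPolynomial.induction_on' with
    | add p q hp hq => simp only [map_add, mul_add, hp, hq]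
    | monomial m a =>
      rw [expand_monomial, monomial_mul, boxTrace_monomial, boxTrace_monomial]
      simp only [Finsupp.add_apply, Finsupp.smul_apply, smul_eq_mul, Nat.mul_add_mod,
        Nat.mul_add_div (Nat.pos_of_ne_zero hn)]
      split_ifs
      · rw [monomial_mul]
        refine congrArg (fun t => monomial t (c * a)) (Finsupp.ext fun i => ?_)
        fin_cases i <;> simp
      · rw [mul_zero]

theorem sum_expand_boxTrace_monomial {F : Type u} [CommSemiring F] {n : ℕ} (hn : n ≠ 0)
    (m : Fin 3 →₀ ℕ) (hm : (n : ℤ) ∣ expWeight m) (a : F) :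
    ∑ j : Fin n × Fin n × Fin n, expand n (boxTrace F n (monomial m a *
      if (n : ℤ) ∣ expWeight (expVec j.1 j.2.1 j.2.2) then
        monomial (expVec (n - 1 - j.1) (n - 1 - j.2.1) (n - 1 - j.2.2)) 1 else 0)) *
      (if (n : ℤ) ∣ expWeight (expVec j.1 j.2.1 j.2.2) then
        monomial (expVec j.1 j.2.1 j.2.2) 1 else 0) = monomial m a := by
  have hn' := Nat.pos_of_ne_zero hn
  let j₀ : Fin n × Fin n × Fin n :=
    (⟨m 0 % n, Nat.mod_lt _ hn'⟩, ⟨m 1 % n, Nat.mod_lt _ hn'⟩, ⟨m 2 % n, Nat.mod_lt _ hn'⟩)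
  have hj₀ : m = n • expVec (m 0 / n) (m 1 / n) (m 2 / n) + expVec j₀.1 j₀.2.1 j₀.2.2 := by
    ext i
    fin_cases i <;> simp [j₀, Nat.div_add_mod]
  have hw : (n : ℤ) ∣ expWeight (expVec j₀.1 j₀.2.1 j₀.2.2) := by
    rw [hj₀, map_add, map_nsmul, nsmul_eq_mul] at hm
    exact (dvd_add_right (Dvd.intro _ rfl)).1 hm
  have key : ∀ x y : ℕ, y < n → ((x + (n - 1 - y)) % n = n - 1 ↔ y = x % n) := by
    intro x y hy
    have hx := Nat.mod_lt x hn'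
    have e : (x + (n - 1 - y)) % n = (x % n + (n - 1 - y)) % n := by simp
    rw [e]
    constructor
    · intro h
      rcases lt_or_ge (x % n + (n - 1 - y)) n with h1 | h1
      · rw [Nat.mod_eq_of_lt h1] at h
        lia
      · rw [Nat.mod_eq_sub_mod h1, Nat.mod_eq_of_lt (by lia)] at h
        lia
    · intro h
      rw [← h, Nat.mod_eq_of_lt (by lia)]
      lia
  have key2 : ∀ x : ℕ, (x + (n - 1 - x % n)) / n = x / n := by
    intro x
    have hx := Nat.mod_lt x hn'
    have e : x + (n - 1 - x % n) = n - 1 + n * (x / n) := by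
      have := Nat.mod_add_div x n
      lia
    rw [e, Nat.add_mul_div_left _ _ hn', Nat.div_eq_of_lt (by lia), zero_add]
  rw [Finset.sum_eq_single j₀]
  · rw [if_pos hw, if_pos hw, monomial_mul, mul_one, boxTrace_monomial, if_pos]
    · rw [expand_monomial, monomial_mul, mul_one]
      congr 1
      conv_rhs => rw [hj₀]
      congr 2
      simp only [Finsupp.add_apply, expVec_zero, expVec_one, expVec_two, j₀, key2]
    · intro i
      fin_cases i <;> simp only [Fin.zero_eta, Fin.mk_one, Fin.reduceFinMk, Finsupp.add_apply,
        expVec_zero, expVec_one, expVec_two] <;> rw [key _ _ (Fin.is_lt _)]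
  · intro j _ hj
    split_ifs with h
    · rw [monomial_mul, boxTrace_monomial, if_neg, map_zero, zero_mul]
      intro hall
      apply hj
      have e0 := hall 0
      have e1 := hall 1
      have e2 := hall 2
      simp only [Finsupp.add_apply, expVec_zero, expVec_one, expVec_two] at e0 e1 e2
      rw [key _ _ (Fin.is_lt _)] at e0 e1 e2
      exact Prod.ext (Fin.ext e0) (Prod.ext (Fin.ext e1) (Fin.ext e2))
    · simp
  · simp

theorem isGorensteinRing_weightRing (F : Type u) [Field F] {n : ℕ} (hn : n ≠ 0) (h10 : n ∣ 10) :
    IsGorensteinRing (weightRing F n) := by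
  have hexp : ∀ b : MvPolynomial (Fin 3) F, expand n b ∈ weightRing F n := by
    intro b
    induction b using MvPolynomial.induction_on' with
    | add p q hp hq =>
      rw [map_add]
      exact add_mem hp hq
    | monomial k c =>
      rw [expand_monomial]
      refine monomial_mem_weightRing _ ?_
      rw [map_nsmul, nsmul_eq_mul]
      exact Dvd.intro _ rfl
  let _ : Algebra (MvPolynomial (Fin 3) F) (weightRing F n) :=
    ((expand n : MvPolynomial (Fin 3) F →ₐ[F] _).codRestrict (weightRing F n) hexp).toRingHom.toAlgebra
  have hsmul : ∀ (b : MvPolynomial (Fin 3) F) (P : weightRing F n),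
      ((b • P : weightRing F n) : MvPolynomial (Fin 3) F) = expand n b * P := fun b P => rfl
  let φ : weightRing F n →ₗ[MvPolynomial (Fin 3) F] MvPolynomial (Fin 3) F :=
    { toFun := fun P => boxTrace F n P
      map_add' := fun P Q => map_add (boxTrace F n) P.1 Q.1
      map_smul' := fun b P => boxTrace_expand_mul hn b P }
  let u (j : Fin n × Fin n × Fin n) : weightRing F n :=
    ⟨if (n : ℤ) ∣ expWeight (expVec j.1 j.2.1 j.2.2) then
        monomial (expVec j.1 j.2.1 j.2.2) 1 else 0, by
      split_ifs with h
      exacts [monomial_mem_weightRing _ h, zero_mem _]⟩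
  let v (j : Fin n × Fin n × Fin n) : weightRing F n :=
    ⟨if (n : ℤ) ∣ expWeight (expVec j.1 j.2.1 j.2.2) then
        monomial (expVec (n - 1 - j.1) (n - 1 - j.2.1) (n - 1 - j.2.2)) 1 else 0, by
      split_ifs with h
      · refine monomial_mem_weightRing _ ?_
        have h1 : expWeight (expVec (n - 1 - j.1) (n - 1 - j.2.1) (n - 1 - j.2.2)) =
            n * 10 - (10 + expWeight (expVec j.1 j.2.1 j.2.2)) := by
          have h0 := j.1.is_lt
          have h1 := j.2.1.is_lt
          have h2 := j.2.2.is_lt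
          simp only [expWeight_apply, expVec_zero, expVec_one, expVec_two]
          lia
        rw [h1]
        exact dvd_sub (Dvd.intro _ rfl) (dvd_add (by exact_mod_cast h10) h)
      · exact zero_mem _⟩
  refine isGorensteinRing_of_frobenius (globalDimensionLE_mvPolynomial_fin F 3) φ u v fun r => ?_
  apply Subtype.ext
  rw [AddSubmonoidClass.coe_finsetSum]
  simp only [hsmul]
  change ∑ j, expand n (boxTrace F n (r.1 * (v j).1)) * (u j).1 = r.1
  conv_lhs => rw [r.1.as_sum]
  simp only [Finset.sum_mul, map_sum]
  rw [Finset.sum_comm]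
  conv_rhs => rw [r.1.as_sum]
  exact Finset.sum_congr rfl fun m hm => sum_expand_boxTrace_monomial hn m (r.2 m hm) _

/-- The first standard generator of `SL(2, 5)`, of order three. -/
def slA : SpecialLinearGroup (Fin 2) (ZMod 5) := ⟨!![0, -1; 1, -1], by rw [det_fin_two]; decide⟩

/-- The second standard generator of `SL(2, 5)`, of order three. -/
def slB : SpecialLinearGroup (Fin 2) (ZMod 5) := ⟨!![0, 1; -1, -1], by rw [det_fin_two]; decide⟩

/-- An order three element which together with `slA` forms the generating pair that is
algebraically conjugate to `slA, slB`. -/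
def slB' : SpecialLinearGroup (Fin 2) (ZMod 5) := ⟨!![-1, -1; 1, 0], by rw [det_fin_two]; decide⟩

theorem closure_slA_slB : Subgroup.closure {slA, slB} = ⊤ := by
  let U (k : ZMod 5) : SpecialLinearGroup (Fin 2) (ZMod 5) :=
    ⟨!![1, k; 0, 1], by rw [det_fin_two]; simp⟩
  let L (k : ZMod 5) : SpecialLinearGroup (Fin 2) (ZMod 5) :=
    ⟨!![1, 0; k, 1], by rw [det_fin_two]; simp⟩
  set H := Subgroup.closure {slA, slB}
  have ha : slA ∈ H := Subgroup.subset_closure (by simp)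
  have hb : slB ∈ H := Subgroup.subset_closure (by simp)
  have hU1 : U 1 ∈ H := by
    have : U 1 = slB * slB * slA * slB * slB * slA := by
      apply Subtype.ext; ext i j; fin_cases i <;> fin_cases j <;> decide
    rw [this]
    exact mul_mem (mul_mem (mul_mem (mul_mem (mul_mem hb hb) ha) hb) hb) ha
  have hL1 : L 1 ∈ H := by
    have : L 1 = slB * slA * slA * slB * slA * slA := by
      apply Subtype.ext; ext i j; fin_cases i <;> fin_cases j <;> decide
    rw [this]
    exact mul_mem (mul_mem (mul_mem (mul_mem (mul_mem hb ha) ha) hb) ha) ha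
  have hUm : ∀ x y, U (x + y) = U x * U y := fun x y => by
    apply Subtype.ext
    show _ = (U x).1 * (U y).1
    simp [U, add_comm]
  have hLm : ∀ x y, L (x + y) = L x * L y := fun x y => by
    apply Subtype.ext
    show _ = (L x).1 * (L y).1
    simp [L]
  have hU : ∀ k, U k ∈ H := fun k => by
    have : ∀ n : ℕ, U n ∈ H := fun n => by
      induction n with
      | zero =>
        convert one_mem H
        apply Subtype.ext
        simp [U, one_fin_two]
      | succ n ih => rw [Nat.cast_succ, hUm]; exact mul_mem ih hU1
    simpa using this k.val
  have hL : ∀ k, L k ∈ H := fun k => by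
    have : ∀ n : ℕ, L n ∈ H := fun n => by
      induction n with
      | zero =>
        convert one_mem H
        apply Subtype.ext
        simp [L, one_fin_two]
      | succ n ih => rw [Nat.cast_succ, hLm]; exact mul_mem ih hL1
    simpa using this k.val
  have key : ∀ M : SpecialLinearGroup (Fin 2) (ZMod 5), M.1 1 0 ≠ 0 → M ∈ H := fun M hr => by
    have : Fact (Nat.Prime 5) := ⟨by norm_num⟩
    have hd := M.2
    rw [det_fin_two] at hd
    have : M = U ((M.1 0 0 - 1) / M.1 1 0) * L (M.1 1 0) * U ((M.1 1 1 - 1) / M.1 1 0) := by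
      apply Subtype.ext
      show _ = (U _).1 * (L _).1 * (U _).1
      ext i j
      fin_cases i <;> fin_cases j <;> simp [U, L] <;> field_simp <;>
      first | linear_combination 0 * hd | linear_combination hd | linear_combination -hd
    rw [this]
    exact mul_mem (mul_mem (hU _) (hL _)) (hU _)
  refine eq_top_iff.2 fun M _ => ?_
  by_cases hr : M.1 1 0 = 0
  · have hd := M.2
    rw [det_fin_two] at hd
    have : L 1 * M ∈ H := key _ (by
      show ((L 1).1 * M.1) 1 0 ≠ 0
      intro h
      simp [L, Matrix.mul_apply, Fin.sum_univ_two, hr] at h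
      rw [h, hr, zero_mul, mul_zero, sub_zero] at hd
      exact absurd hd (by decide))
    exact (Subgroup.mul_mem_cancel_left _ (hL 1)).1 this
  · exact key M hr

theorem slA_pow_three : slA ^ 3 = 1 := by
  apply Subtype.ext; ext i j; fin_cases i <;> fin_cases j <;> decide

theorem slB_pow_three : slB ^ 3 = 1 := by
  apply Subtype.ext; ext i j; fin_cases i <;> fin_cases j <;> decide

theorem slA_mul_slB_pow_five : (slA * slB) ^ 5 = -1 := by
  apply Subtype.ext; ext i j; fin_cases i <;> fin_cases j <;> decide

theorem slA_ne_one : slA ≠ 1 := fun h => by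
  have := congrArg (fun M => M.1 0 0) h
  revert this; decide

theorem slB_ne_one : slB ≠ 1 := fun h => by
  have := congrArg (fun M => M.1 0 0) h
  revert this; decide

theorem slA_mul_slB_ne : slA * slB ≠ slB * slA := fun h => by
  have := congrArg (fun M => M.1 0 1) h
  revert this; decide

theorem neg_one_sl_ne_one : (-1 : SpecialLinearGroup (Fin 2) (ZMod 5)) ≠ 1 := fun h => by
  have := congrArg (fun M => M.1 0 0) h
  revert this; decide

theorem exists_conj_slA_mul_slB' : ∃ d : SpecialLinearGroup (Fin 2) (ZMod 5),
    d * (slA * slB) ^ 3 = (slA * slB') * d := by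
  refine ⟨⟨!![1, 3; 0, 1], by rw [det_fin_two]; decide⟩, ?_⟩
  apply Subtype.ext; ext i j; fin_cases i <;> fin_cases j <;> decide

theorem mul_self_fin_two {F : Type u} [CommRing F] (M : Matrix (Fin 2) (Fin 2) F) :
    M * M = M.trace • M - M.det • 1 := by
  rw [eta_fin_two M]
  ext i j
  fin_cases i <;> fin_cases j <;> simp [trace_fin_two, det_fin_two] <;> ring

theorem three_eq_zero (F : Type u) [Field F] [CharP F 3] : (3 : F) = 0 := by
  exact_mod_cast CharP.cast_eq_zero F 3

theorem eq_one_of_pow_three {F : Type u} [Field F] [CharP F 3] {d : F} (h : d ^ 3 = 1) : d = 1 := by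
  have h3 := three_eq_zero F
  have : (d - 1) ^ 3 = 0 := by linear_combination h + (d - d ^ 2) * h3
  exact sub_eq_zero.1 (pow_eq_zero_iff (by norm_num) |>.1 this)

theorem trace_of_pow_three {F : Type u} [Field F] [CharP F 3] {A : Matrix (Fin 2) (Fin 2) F}
    (hd : A.det = 1) (h : A ^ 3 = 1) (h1 : A ≠ 1) : A.trace = 2 := by
  have h3 := three_eq_zero F
  have h2 := mul_self_fin_two A
  rw [hd, one_smul] at h2
  have e : (A.trace ^ 2 - 1) • A = (A.trace + 1) • (1 : Matrix (Fin 2) (Fin 2) F) := by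
    have : A ^ 3 = (A.trace ^ 2 - 1) • A - A.trace • 1 := by
      rw [pow_succ, pow_two, h2, sub_mul, smul_mul_assoc, h2, one_mul]
      module
    rw [this] at h
    rw [sub_eq_iff_eq_add.1 h]
    module
  by_cases ht : A.trace ^ 2 - 1 = 0
  · have := congrFun (congrFun e 0) 0
    simp [ht] at this
    linear_combination -this - h3
  · exfalso
    have hA : A = ((A.trace + 1) / (A.trace ^ 2 - 1)) • (1 : Matrix (Fin 2) (Fin 2) F) := by
      rw [div_eq_inv_mul, mul_smul, ← e, smul_smul, inv_mul_cancel₀ ht, one_smul]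
    generalize (A.trace + 1) / (A.trace ^ 2 - 1) = s at hA
    rw [hA, smul_pow, one_pow] at h
    have hs := congrFun (congrFun h 0) 0
    simp at hs
    rw [eq_one_of_pow_three hs, one_smul] at hA
    exact h1 hA

theorem exists_nilpotent_form {F : Type u} [Field F] {A : Matrix (Fin 2) (Fin 2) F}
    (hd : A.det = 1) (ht : A.trace = 2) (h1 : A ≠ 1) :
    ∃ u₀ u₁ c : F, A = !![1 + c * u₀ * u₁, -c * u₀ ^ 2; c * u₁ ^ 2, 1 - c * u₀ * u₁] := by
  rw [eta_fin_two A] at *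
  generalize A 0 0 = p at *
  generalize A 0 1 = q at *
  generalize A 1 0 = r at *
  generalize A 1 1 = s at *
  rw [det_fin_two_of] at hd
  rw [trace_fin_two_of] at ht
  have hs : s = 2 - p := by linear_combination ht
  subst hs
  by_cases hr : r = 0
  · subst hr
    have : p - 1 = 0 := by
      have : (p - 1) ^ 2 = 0 := by linear_combination -hd
      exact pow_eq_zero_iff (by norm_num) |>.1 this
    have hp : p = 1 := by linear_combination this
    subst hp
    refine ⟨1, 0, -q, ?_⟩
    congr! 4 <;> ring_nf
  · refine ⟨p - 1, r, r⁻¹, ?_⟩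
    congr! 4 <;> field_simp
    · ring
    · linear_combination -hd
    · ring_nf

theorem map_slA_mul_slB_ne {F : Type u} [Field F]
    {φ : SpecialLinearGroup (Fin 2) (ZMod 5) →* Matrix (Fin 2) (Fin 2) F} (hφ : Function.Injective φ) :
    φ slA * φ slB ≠ φ slB * φ slA := fun h => by
  rw [← map_mul, ← map_mul] at h
  exact slA_mul_slB_ne (hφ h)

section

variable {F : Type u} [Field F] [CharP F 3]
  {φ : SpecialLinearGroup (Fin 2) (ZMod 5) →* Matrix (Fin 2) (Fin 2) F}

theorem det_sl_two_five_hom (φ : SpecialLinearGroup (Fin 2) (ZMod 5) →* Matrix (Fin 2) (Fin 2) F)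
    (x : SpecialLinearGroup (Fin 2) (ZMod 5)) : (φ x).det = 1 := by
  have hx : x ∈ Subgroup.closure {slA, slB} := closure_slA_slB ▸ Subgroup.mem_top x
  induction hx using Subgroup.closure_induction with
  | mem y hy =>
    apply eq_one_of_pow_three
    rw [← det_pow, ← map_pow]
    rcases hy with rfl | rfl
    · rw [slA_pow_three]; simp
    · rw [slB_pow_three]; simp
  | one => simp
  | mul y z _ _ hy hz => rw [map_mul, det_mul, hy, hz, one_mul]
  | inv y _ hy =>
    have : (φ y⁻¹ * φ y).det = 1 := by rw [← map_mul]; simp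
    rwa [det_mul, hy, mul_one] at this

theorem map_neg_one_sl_two_five (hφ : Function.Injective φ) : φ (-1) = -1 := by
  have h3 := three_eq_zero F
  have h2 := mul_self_fin_two (φ (-1))
  have h1 : φ (-1) * φ (-1) = 1 := by rw [← map_mul]; simp
  have hd := det_sl_two_five_hom φ (-1)
  have hne : φ (-1) ≠ 1 := fun h => neg_one_sl_ne_one (hφ (h.trans (map_one φ).symm))
  rw [h1, hd, one_smul] at h2
  generalize φ (-1) = A at *
  generalize A.trace = t at *
  have ht : t ≠ 0 := by
    rintro rfl
    have := congrFun (congrFun h2 0) 0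
    simp at this
    have h0 : (1 : F) = 0 := by linear_combination -this + h3
    exact one_ne_zero h0
  have hA : A = (-t⁻¹) • (1 : Matrix (Fin 2) (Fin 2) F) := by
    have e : t • A = (-1 : F) • (1 : Matrix (Fin 2) (Fin 2) F) := by
      have : (3 : F) • (1 : Matrix (Fin 2) (Fin 2) F) = 0 := by rw [h3, zero_smul]
      have h4 : t • A = (2 : F) • (1 : Matrix (Fin 2) (Fin 2) F) := by
        rw [eq_sub_iff_add_eq] at h2
        rw [← h2]; module
      rw [h4, ← sub_eq_zero, ← this]
      module
    calc A = t⁻¹ • t • A := by rw [smul_smul, inv_mul_cancel₀ ht, one_smul]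
      _ = _ := by rw [e]; module
  generalize -t⁻¹ = s at hA
  subst hA
  have hs := congrFun (congrFun h1 0) 0
  simp at hs
  rcases mul_self_eq_one_iff.1 hs with rfl | rfl
  · exact absurd (one_smul _ _) hne
  · simp

theorem trace_map_slA_mul_slB (hφ : Function.Injective φ) :
    (φ (slA * slB)).trace ^ 2 = (φ (slA * slB)).trace + 1 := by
  have h3 := three_eq_zero F
  have h2 := mul_self_fin_two (φ (slA * slB))
  have h5 : φ (slA * slB) ^ 5 = -1 := by
    rw [← map_pow, slA_mul_slB_pow_five, map_neg_one_sl_two_five hφ]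
  rw [det_sl_two_five_hom, one_smul] at h2
  have hns : ∀ s : F, φ (slA * slB) ≠ s • (1 : Matrix (Fin 2) (Fin 2) F) := fun s hs => by
    apply slA_mul_slB_ne
    have : slA * (slA * slB) = (slA * slB) * slA := hφ (by rw [map_mul, map_mul φ (slA * slB), hs]; simp)
    rw [mul_assoc] at this
    exact mul_left_cancel this
  generalize φ (slA * slB) = C at *
  generalize C.trace = t at *
  have e : (t ^ 4 + 1) • C = (t ^ 3 + t - 1) • (1 : Matrix (Fin 2) (Fin 2) F) := by
    have e3 : C ^ 3 = (t ^ 2 - 1) • C - t • 1 := by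
      rw [pow_succ, pow_two, h2, sub_mul, smul_mul_assoc, h2, one_mul]
      module
    have e5 : C ^ 5 = (t ^ 4 - 3 * t ^ 2 + 1) • C - (t ^ 3 - 2 * t) • 1 := by
      rw [show 5 = 3 + 1 + 1 from rfl, pow_succ, pow_succ, e3, sub_mul, sub_mul, smul_mul_assoc,
        smul_mul_assoc, smul_mul_assoc, smul_mul_assoc, h2, one_mul, h2, sub_mul, smul_mul_assoc, h2, one_mul]
      module
    rw [h5, h3, show t ^ 3 - 2 * t = t ^ 3 + t by linear_combination -t * h3] at e5
    rw [sub_smul, one_smul, sub_eq_add_neg, e5]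
    module
  have h4 : t ^ 4 + 1 = 0 := by
    by_contra h
    refine hns ((t ^ 4 + 1)⁻¹ * (t ^ 3 + t - 1)) ?_
    rw [mul_smul, ← e, smul_smul, inv_mul_cancel₀ h, one_smul]
  rw [h4, zero_smul] at e
  have h0 := congrFun (congrFun e 0) 0
  simp at h0
  linear_combination -t * h0 - h4

/-- In characteristic three, every faithful two-dimensional representation of `SL(2, 5)` is
conjugate to the one sending the standard generators to `!![1, 1; 0, 1]` and `!![1, 0; β, 1]`
where `β² = -1`. -/
theorem exists_sl_two_five_normal_form (hφ : Function.Injective φ) :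
    ∃ Q : (Matrix (Fin 2) (Fin 2) F)ˣ, ∃ β : F, β ^ 2 = -1 ∧
      φ slA * (Q : Matrix (Fin 2) (Fin 2) F) = (Q : Matrix (Fin 2) (Fin 2) F) * !![1, 1; 0, 1] ∧ φ slB * (Q : Matrix (Fin 2) (Fin 2) F) = (Q : Matrix (Fin 2) (Fin 2) F) * !![1, 0; β, 1] := by
  have h3 := three_eq_zero F
  have hA1 : φ slA ≠ 1 := fun h => slA_ne_one (hφ (h.trans (map_one φ).symm))
  have hB1 : φ slB ≠ 1 := fun h => slB_ne_one (hφ (h.trans (map_one φ).symm))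
  have hA3 : φ slA ^ 3 = 1 := by rw [← map_pow, slA_pow_three, map_one]
  have hB3 : φ slB ^ 3 = 1 := by rw [← map_pow, slB_pow_three, map_one]
  have hAd := det_sl_two_five_hom φ slA
  have hBd := det_sl_two_five_hom φ slB
  obtain ⟨u₀, u₁, c, hA⟩ := exists_nilpotent_form hAd (trace_of_pow_three hAd hA3 hA1) hA1
  obtain ⟨v₀, v₁, d, hB⟩ := exists_nilpotent_form hBd (trace_of_pow_three hBd hB3 hB1) hB1
  have hne := map_slA_mul_slB_ne hφ
  have htr := trace_map_slA_mul_slB hφ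
  rw [map_mul] at htr
  rw [hA] at hA1
  rw [hA, hB] at hne htr ⊢
  set δ := u₀ * v₁ - u₁ * v₀ with hδ
  have hc : c ≠ 0 := by
    rintro rfl
    apply hA1
    simp [one_fin_two]
  have hδ0 : δ ≠ 0 := fun h => hne (by
    rw [hδ] at h
    ext i j
    fin_cases i <;> fin_cases j <;> simp [Matrix.mul_apply, Fin.sum_univ_two]
    · linear_combination (-1 : F) * c * d * (u₀ * v₁ + u₁ * v₀) * h
    · linear_combination 2 * c * d * u₀ * v₀ * h
    · linear_combination -2 * c * d * u₁ * v₁ * h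
    · linear_combination c * d * (u₀ * v₁ + u₁ * v₀) * h)
  have hdet : IsUnit (!![-c * δ * u₀, v₀; -c * δ * u₁, v₁] : Matrix (Fin 2) (Fin 2) F).det := by
    rw [det_fin_two_of, show -c * δ * u₀ * v₁ - v₀ * (-c * δ * u₁) = -c * δ ^ 2 by rw [hδ]; ring]
    exact isUnit_iff_ne_zero.2 (mul_ne_zero (neg_ne_zero.2 hc) (pow_ne_zero 2 hδ0))
  refine ⟨((isUnit_iff_isUnit_det _).2 hdet).unit, -c * d * δ ^ 2, ?_, ?_, ?_⟩
  · rw [trace_fin_two] at htr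
    simp [Matrix.mul_apply, Fin.sum_univ_two] at htr
    have : (2 + -c * d * δ ^ 2) ^ 2 = (2 + -c * d * δ ^ 2) + 1 := by
      rw [hδ]; linear_combination htr
    linear_combination this + (c * d * δ ^ 2) * h3
  · rw [IsUnit.unit_spec]
    ext i j
    fin_cases i <;> fin_cases j <;> simp [Matrix.mul_apply, Fin.sum_univ_two] <;> simp only [hδ] <;> ring
  · rw [IsUnit.unit_spec]
    ext i j
    fin_cases i <;> fin_cases j <;> simp [Matrix.mul_apply, Fin.sum_univ_two] <;> (try simp only [hδ]) <;> ring

end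

theorem trace_sl_two_five_of_pow_three {x : SpecialLinearGroup (Fin 2) (ZMod 5)} (h : x ^ 3 = 1)
    (h1 : x ≠ 1) : x.1 1 1 = -1 - x.1 0 0 := by
  have hd := x.2
  rw [det_fin_two] at hd
  have hx : x.1 ^ 3 = 1 := congrArg Subtype.val h
  have h2 := mul_self_fin_two x.1
  rw [x.2, one_smul] at h2
  have e3 : x.1 ^ 3 = (x.1.trace ^ 2 - 1) • x.1 - x.1.trace • 1 := by
    rw [pow_succ, pow_two, h2, sub_mul, smul_mul_assoc, h2, one_mul]
    module
  rw [e3] at hx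
  have h00 := congrFun (congrFun hx 0) 0
  have h01 := congrFun (congrFun hx 0) 1
  have h10 := congrFun (congrFun hx 1) 0
  have h11 := congrFun (congrFun hx 1) 1
  simp only [trace_fin_two, Matrix.sub_apply, Matrix.smul_apply, smul_eq_mul, one_apply_eq, mul_one]
    at h00 h11
  rw [trace_fin_two, Matrix.sub_apply, Matrix.smul_apply, Matrix.smul_apply,
    one_apply_ne (by decide)] at h01 h10
  simp only [smul_eq_mul, mul_zero, sub_zero] at h01 h10
  have hne : ¬ (x.1 0 0 = 1 ∧ x.1 0 1 = 0 ∧ x.1 1 0 = 0 ∧ x.1 1 1 = 1) := fun ⟨a, b, c, d⟩ => h1 (by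
    apply Subtype.ext
    rw [eta_fin_two x.1, a, b, c, d, ← one_fin_two]
    rfl)
  clear hx e3 h2 h h1
  generalize x.1 0 0 = p at *
  generalize x.1 0 1 = q at *
  generalize x.1 1 0 = r at *
  generalize x.1 1 1 = s at *
  revert p q r s
  decide +kernel

theorem trace_sl_two_five_of_pow_five {x : SpecialLinearGroup (Fin 2) (ZMod 5)} (h : x ^ 5 = -1) :
    x.1 0 0 + x.1 1 1 = 3 := by
  have : Fact (Nat.Prime 5) := ⟨by norm_num⟩
  have hx : x.1 ^ 5 = -1 := congrArg Subtype.val h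
  have := congrArg trace hx
  rw [ZMod.trace_pow_card, ZMod.pow_card, trace_fin_two, trace_neg, trace_one] at this
  rw [this, Fintype.card_fin]
  rfl

theorem exists_conj_slA {x : SpecialLinearGroup (Fin 2) (ZMod 5)} (h : x ^ 3 = 1)
    (h1 : x ≠ 1) : ∃ z, x * z = z * slA := by
  have ht := trace_sl_two_five_of_pow_three h h1
  have hd := x.2
  rw [det_fin_two] at hd
  have key : ∀ p q r s : ZMod 5, p * s - q * r = 1 → s = -1 - p →
      ∃ a b, a * (r * a + s * b) - (p * a + q * b) * b = 1 := by decide +kernel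
  obtain ⟨a, b, hab⟩ := key _ _ _ _ hd ht
  refine ⟨⟨!![a, x.1 0 0 * a + x.1 0 1 * b; b, x.1 1 0 * a + x.1 1 1 * b], ?_⟩, ?_⟩
  · rw [det_fin_two_of]; exact hab
  · apply Subtype.ext
    show x.1 * !![a, x.1 0 0 * a + x.1 0 1 * b; b, x.1 1 0 * a + x.1 1 1 * b] =
      !![a, x.1 0 0 * a + x.1 0 1 * b; b, x.1 1 0 * a + x.1 1 1 * b] * !![0, -1; 1, -1]
    rw [ht] at hd ⊢
    ext i j
    fin_cases i <;> fin_cases j <;> simp [Matrix.mul_apply, Fin.sum_univ_two, ht]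
    · linear_combination -a * hd
    · linear_combination -b * hd

theorem exists_conj_slA_slB {x y : SpecialLinearGroup (Fin 2) (ZMod 5)} (hx : x ^ 3 = 1)
    (hx1 : x ≠ 1) (hy : y ^ 3 = 1) (hy1 : y ≠ 1) (hxy : (x * y) ^ 5 = -1) :
    ∃ z, x * z = z * slA ∧ (y * z = z * slB ∨ y * z = z * slB') := by
  obtain ⟨z, hz⟩ := exists_conj_slA hx hx1
  suffices h : ∀ w : SpecialLinearGroup (Fin 2) (ZMod 5), w ^ 3 = 1 → w ≠ 1 → (slA * w) ^ 5 = -1 →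
      ∃ k : ℕ, w * slA ^ k = slA ^ k * slB ∨ w * slA ^ k = slA ^ k * slB' by
    have hxz : x = z * slA * z⁻¹ := by rw [← hz]; group
    obtain ⟨k, hk⟩ := h (z⁻¹ * y * z) (by
        have : (z⁻¹ * y * z) ^ 3 = z⁻¹ * y ^ 3 * z := by
          simpa using conj_pow (a := z⁻¹) (b := y) (i := 3)
        rw [this, hy]; group) (fun h => hy1 (by
        have : y = z * (z⁻¹ * y * z) * z⁻¹ := by group
        rw [this, h]; group)) (by
        have : (slA * (z⁻¹ * y * z)) ^ 5 = z⁻¹ * (x * y) ^ 5 * z := by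
          have e : slA * (z⁻¹ * y * z) = z⁻¹ * (x * y) * z := by rw [hxz]; group
          rw [e]
          simpa using conj_pow (a := z⁻¹) (b := x * y) (i := 5)
        rw [this, hxy]; simp)
    refine ⟨z * slA ^ k, ?_, ?_⟩
    · rw [← mul_assoc, hz, mul_assoc, mul_assoc, ← pow_succ', pow_succ]
    · have e : y * (z * slA ^ k) = z * ((z⁻¹ * y * z) * slA ^ k) := by group
      rw [e]
      refine hk.imp (fun h => ?_) fun h => ?_ <;> rw [h, mul_assoc]
  clear hxy hy1 hy hx1 hx hz x y z
  intro w hw hw1 h5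
  have ht := trace_sl_two_five_of_pow_three hw hw1
  have h3 := trace_sl_two_five_of_pow_five h5
  have hd := w.2
  rw [det_fin_two] at hd
  have h3' : -w.1 1 0 + (w.1 0 1 - w.1 1 1) = 3 := by
    rw [← h3]
    show _ = (slA.1 * w.1) 0 0 + (slA.1 * w.1) 1 1
    simp [slA, Matrix.mul_apply, Fin.sum_univ_two]
    ring
  have key : ∀ p q r s : ZMod 5, p * s - q * r = 1 → s = -1 - p → -r + (q - s) = 3 →
      !![p, q; r, s] = !![3, 3; 4, 1] ∨ !![p, q; r, s] = !![0, 1; 4, 4] ∨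
      !![p, q; r, s] = !![3, 1; 2, 1] ∨ !![p, q; r, s] = !![1, 2; 1, 3] ∨
      !![p, q; r, s] = !![1, 4; 3, 3] ∨ !![p, q; r, s] = !![4, 4; 1, 0] := by decide +kernel
  have hk := key _ _ _ _ hd ht h3'
  rw [← eta_fin_two w.1] at hk
  have hw' (k : ℕ) (v : SpecialLinearGroup (Fin 2) (ZMod 5)) :
      w * slA ^ k = slA ^ k * v ↔ w.1 * slA.1 ^ k = slA.1 ^ k * v.1 := Subtype.ext_iff
  simp only [hw']
  have H : ∀ M : Matrix (Fin 2) (Fin 2) (ZMod 5), M ∈ [!![3, 3; 4, 1], !![0, 1; 4, 4],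
      !![3, 1; 2, 1], !![1, 2; 1, 3], !![1, 4; 3, 3], !![4, 4; 1, 0]] → ∃ k < 3,
      M * !![0, -1; 1, -1] ^ k = !![0, -1; 1, -1] ^ k * !![0, 1; -1, -1] ∨
      M * !![0, -1; 1, -1] ^ k = !![0, -1; 1, -1] ^ k * !![-1, -1; 1, 0] := by
    decide +kernel
  obtain ⟨k, _, hk⟩ := H w.1 (by simpa using hk)
  exact ⟨k, hk⟩

/-- The normalizer of the image of a faithful two-dimensional representation of `SL(2, 5)` in
characteristic three is generated by this image and scalars. -/
theorem eq_smul_of_normalizes {F : Type u} [Field F] [CharP F 3]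
    {φ : SpecialLinearGroup (Fin 2) (ZMod 5) →* Matrix (Fin 2) (Fin 2) F}
    (hφ : Function.Injective φ) (M : (Matrix (Fin 2) (Fin 2) F)ˣ)
    (hM : ∀ x, ∃ y, (M : Matrix (Fin 2) (Fin 2) F) * φ x = φ y * M) :
    ∃ y, ∃ c : F, (M : Matrix (Fin 2) (Fin 2) F) = c • φ y := by
  choose ψ hψ using hM
  have h3 := three_eq_zero F
  have hcan : ∀ {x y}, φ x * (M : Matrix (Fin 2) (Fin 2) F) = φ y * M → x = y := fun h =>
    hφ (M.isUnit.mul_left_injective h)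
  have hmul : ∀ x y, ψ (x * y) = ψ x * ψ y := fun x y => hcan (by
    rw [← hψ, map_mul, ← mul_assoc, hψ, mul_assoc, hψ, ← mul_assoc, map_mul])
  have hone : ψ 1 = 1 := hcan (by rw [← hψ, map_one, mul_one, one_mul])
  have hneg : ψ (-1) = -1 := hcan (by
    rw [← hψ, map_neg_one_sl_two_five hφ]; simp)
  let Ψ : SpecialLinearGroup (Fin 2) (ZMod 5) →* SpecialLinearGroup (Fin 2) (ZMod 5) :=
    { toFun := ψ, map_one' := hone, map_mul' := hmul }
  have hinj : ∀ x, ψ x = 1 → x = 1 := fun x hx => by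
    have := hψ x
    rw [hx, map_one, one_mul] at this
    exact hφ (M.isUnit.mul_right_injective (this.trans (by simp)))
  obtain ⟨z, hzA, hzB⟩ := exists_conj_slA_slB (x := Ψ slA) (y := Ψ slB)
    (by rw [← map_pow, slA_pow_three, map_one]) (fun h => slA_ne_one (hinj _ h))
    (by rw [← map_pow, slB_pow_three, map_one]) (fun h => slB_ne_one (hinj _ h))
    (by rw [← map_mul, ← map_pow, slA_mul_slB_pow_five]; exact hneg)
  set N : Matrix (Fin 2) (Fin 2) F := φ z⁻¹ * M with hN
  have hMN : (M : Matrix (Fin 2) (Fin 2) F) = φ z * N := by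
    rw [hN, ← mul_assoc, ← map_mul]; simp
  have hNu : IsUnit N.det := by
    rw [hN, det_mul, det_sl_two_five_hom, one_mul]
    exact (isUnit_iff_isUnit_det _).1 M.isUnit
  have hconj : ∀ {x x'}, Ψ x * z = z * x' → N * φ x = φ x' * N := fun {x x'} h => by
    have : z⁻¹ * Ψ x = x' * z⁻¹ := by
      rw [eq_mul_inv_iff_mul_eq, mul_assoc, h]; group
    rw [hN, mul_assoc, hψ, ← mul_assoc, ← map_mul, ← mul_assoc, ← map_mul]
    exact congrArg (fun w => φ w * (M : Matrix (Fin 2) (Fin 2) F)) this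
  have hNA := hconj hzA
  rcases hzB with hzB | hzB
  · have hNB := hconj hzB
    obtain ⟨Q, β, hβ, hQA, hQB⟩ := exists_sl_two_five_normal_form hφ
    set R : Matrix (Fin 2) (Fin 2) F := (↑Q⁻¹ : Matrix (Fin 2) (Fin 2) F) * N * Q with hR
    have hQR : N * (Q : Matrix (Fin 2) (Fin 2) F) = Q * R := by
      rw [hR, ← mul_assoc, ← mul_assoc, Units.mul_inv, one_mul]
    have hRc : ∀ {X Y : Matrix (Fin 2) (Fin 2) F}, X * (Q : Matrix (Fin 2) (Fin 2) F) = Q * Y →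
        N * X = X * N → R * Y = Y * R := fun {X Y} h1 h2 => by
      apply Q.isUnit.mul_right_injective
      show (Q : Matrix (Fin 2) (Fin 2) F) * (R * Y) = Q * (Y * R)
      rw [← mul_assoc, ← hQR, mul_assoc, ← h1, ← mul_assoc, h2, mul_assoc, hQR, ← mul_assoc, h1,
        mul_assoc]
    have h1 := hRc hQA hNA
    have h2 := hRc hQB hNB
    have hβ0 : β ≠ 0 := by rintro rfl; simp at hβ
    have e1 := congrFun (congrFun h1 0) 0
    have e2 := congrFun (congrFun h1 0) 1
    have e3 := congrFun (congrFun h2 0) 0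
    simp [Matrix.mul_apply, Fin.sum_univ_two] at e1 e2 e3
    have e3' : R 0 1 = 0 := e3.resolve_right hβ0
    have hRs : R = R 0 0 • (1 : Matrix (Fin 2) (Fin 2) F) := by
      ext i j
      fin_cases i <;> fin_cases j <;> simp [e1, e3']
      linear_combination -e2
    refine ⟨z, R 0 0, ?_⟩
    have hNs : N = R 0 0 • (1 : Matrix (Fin 2) (Fin 2) F) := by
      apply Q.isUnit.mul_left_injective
      show N * (Q : Matrix (Fin 2) (Fin 2) F) = R 0 0 • 1 * Q
      rw [hQR, hRs]
      simp
    rw [hMN, hNs]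
    simp
  · exfalso
    have hNB := hconj hzB
    have ht := trace_map_slA_mul_slB hφ
    have htr : (φ (slA * slB')).trace = (φ (slA * slB)).trace := by
      have : N * φ (slA * slB) = φ (slA * slB') * N := by
        rw [map_mul, ← mul_assoc, hNA, mul_assoc, hNB, ← mul_assoc, map_mul]
      have e : φ (slA * slB') = N * φ (slA * slB) * N⁻¹ := by
        rw [this, mul_assoc, mul_nonsing_inv _ hNu, mul_one]
      rw [e, trace_mul_comm, ← mul_assoc, nonsing_inv_mul _ hNu, one_mul]
    obtain ⟨d, hd⟩ := exists_conj_slA_mul_slB'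
    have htr' : (φ (slA * slB')).trace = (φ (slA * slB) ^ 3).trace := by
      have e : slA * slB' = d * (slA * slB) ^ 3 * d⁻¹ := by rw [hd]; group
      rw [e, map_mul, trace_mul_comm, ← map_mul, ← map_pow]
      congr 2
      group
    have h2 := mul_self_fin_two (φ (slA * slB))
    rw [det_sl_two_five_hom, one_smul] at h2
    rw [htr] at htr'
    generalize φ (slA * slB) = C at *
    have e3 : C ^ 3 = (C.trace ^ 2 - 1) • C - C.trace • 1 := by
      rw [pow_succ, pow_two, h2, sub_mul, smul_mul_assoc, h2, one_mul]
      module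
    rw [e3, trace_sub, trace_smul, trace_smul, trace_one] at htr'
    simp at htr'
    generalize C.trace = t at *
    have h1 : t = -1 := by linear_combination -htr' - (t + 1) * ht + t * h3
    rw [h1] at ht
    exact one_ne_zero (α := F) (by linear_combination ht)

section

variable {F : Type u} [Field F]

theorem polyAct_X {m : ℕ} (M : Matrix (Fin m) (Fin m) F) (i : Fin m) :
    polyAct M (X i) = ∑ j, M i j • (X j : MvPolynomial (Fin m) F) := by
  simp [polyAct]

theorem polyAct_mul {m : ℕ} (M N : Matrix (Fin m) (Fin m) F) (p : MvPolynomial (Fin m) F) :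
    polyAct (M * N) p = polyAct N (polyAct M p) := by
  have : polyAct (M * N) = (polyAct N).comp (polyAct M) := by
    ext1 i
    rw [AlgHom.comp_apply, polyAct_X, polyAct_X, map_sum]
    simp only [map_smul, polyAct_X, Finset.smul_sum, smul_smul, Matrix.mul_apply, Finset.sum_smul]
    exact Finset.sum_comm
  rw [this, AlgHom.comp_apply]

theorem polyAct_one {m : ℕ} (p : MvPolynomial (Fin m) F) : polyAct (1 : Matrix (Fin m) (Fin m) F) p = p := by
  have : polyAct (1 : Matrix (Fin m) (Fin m) F) = AlgHom.id F _ := by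
    ext1 i
    rw [polyAct_X]
    simp [Matrix.one_apply]
  rw [this, AlgHom.id_apply]

theorem coeff_polyAct_diagonal {m : ℕ} (d : Fin m → F) (p : MvPolynomial (Fin m) F)
    (k : Fin m →₀ ℕ) : coeff k (polyAct (diagonal d) p) = (∏ i, d i ^ k i) * coeff k p := by
  classical
  induction p using MvPolynomial.induction_on' with
  | monomial n a =>
    have : polyAct (diagonal d) (monomial n a) = monomial n ((∏ i, d i ^ n i) * a) := by
      have hX (i : Fin m) : polyAct (diagonal d) (X i) = C (d i) * X i := by
        rw [polyAct_X, Finset.sum_eq_single i]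
        · rw [diagonal_apply_eq, smul_eq_C_mul]
        · intro j _ hj
          rw [diagonal_apply_ne _ hj.symm, zero_smul]
        · simp
      rw [monomial_eq (s := n) (a := a), map_mul, Finsupp.prod_fintype _ _ (by simp), map_prod]
      simp only [map_pow, hX, mul_pow, Finset.prod_mul_distrib]
      rw [monomial_eq, Finsupp.prod_fintype _ _ (by simp), C_mul, map_prod]
      simp only [map_pow]
      rw [show polyAct (diagonal d) (C a) = C a from (polyAct (diagonal d)).commutes a]
      ring
    rw [this, coeff_monomial, coeff_monomial]
    split_ifs with h
    · rw [h]
    · simp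
  | add p q hp hq => rw [map_add, coeff_add, hp, hq, coeff_add, mul_add]

/-- The block matrix `1 ⊕ !![p, q; r, s]`. -/
def blockMat (p q r s : F) : Matrix (Fin 3) (Fin 3) F := !![1, 0, 0; 0, p, q; 0, r, s]

theorem blockMat_mul (p q r s p' q' r' s' : F) :
    blockMat p q r s * blockMat p' q' r' s' =
      blockMat (p * p' + q * r') (p * q' + q * s') (r * p' + s * r') (r * q' + s * s') := by
  ext i j
  fin_cases i <;> fin_cases j <;> simp [blockMat, Matrix.mul_apply, Fin.sum_univ_three]

theorem polyAct_blockMat_X_zero (p q r s : F) : polyAct (blockMat p q r s) (X 0) = X 0 := by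
  rw [polyAct_X]; simp [Fin.sum_univ_three, blockMat]

theorem polyAct_blockMat_X_one (p q r s : F) :
    polyAct (blockMat p q r s) (X 1) = C p * X 1 + C q * X 2 := by
  rw [polyAct_X]; simp [Fin.sum_univ_three, blockMat, smul_eq_C_mul]

theorem polyAct_blockMat_X_two (p q r s : F) :
    polyAct (blockMat p q r s) (X 2) = C r * X 1 + C s * X 2 := by
  rw [polyAct_X]; simp [Fin.sum_univ_three, blockMat, smul_eq_C_mul]

/-- The invariant of degree ten of `SL(2, 5)` in characteristic three. -/
def invTen (F : Type u) [Field F] : MvPolynomial (Fin 3) F := X 1 * X 2 ^ 9 - X 1 ^ 9 * X 2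

/-- The invariant of degree twelve of `SL(2, 5)` in characteristic three. -/
def invTwelve (F : Type u) [Field F] : MvPolynomial (Fin 3) F :=
  X 1 ^ 12 - X 1 ^ 10 * X 2 ^ 2 + X 1 ^ 6 * X 2 ^ 6 - X 1 ^ 2 * X 2 ^ 10 - X 2 ^ 12

theorem three_eq_zero_mvPolynomial (F : Type u) [Field F] [CharP F 3] :
    (3 : MvPolynomial (Fin 3) F) = 0 := by
  have := congrArg (C : F → MvPolynomial (Fin 3) F) (three_eq_zero F)
  rwa [map_ofNat, C_0] at this

/-- The conditions of being fixed by the two generators of `SL(2, 5)`. -/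
def FixedBySL (β : F) (p : MvPolynomial (Fin 3) F) : Prop :=
  polyAct (blockMat 1 1 0 1) p = p ∧ polyAct (blockMat 1 0 β 1) p = p

theorem fixedBySL_X_zero (β : F) : FixedBySL β (X 0) :=
  ⟨polyAct_blockMat_X_zero _ _ _ _, polyAct_blockMat_X_zero _ _ _ _⟩

theorem add_pow_three_of_three_eq_zero {R : Type*} [CommRing R] (h3 : (3 : R) = 0) (x y : R) :
    (x + y) ^ 3 = x ^ 3 + y ^ 3 := by
  linear_combination (x ^ 2 * y + x * y ^ 2) * h3

theorem add_pow_nine_of_three_eq_zero {R : Type*} [CommRing R] (h3 : (3 : R) = 0) (x y : R) :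
    (x + y) ^ 9 = x ^ 9 + y ^ 9 := by
  rw [show 9 = 3 * 3 from rfl, pow_mul, add_pow_three_of_three_eq_zero h3,
    add_pow_three_of_three_eq_zero h3, pow_mul, pow_mul]

theorem fixedBySL_invTen [CharP F 3] {β : F} (hβ : β ^ 2 = -1) : FixedBySL β (invTen F) := by
  have h3 := three_eq_zero_mvPolynomial F
  have hb : (C β : MvPolynomial (Fin 3) F) ^ 2 = -1 := by rw [← C_pow, hβ]; simp
  constructor
  · simp only [invTen, map_sub, map_mul, map_pow, polyAct_blockMat_X_one, polyAct_blockMat_X_two]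
    simp only [C_1, C_0, one_mul, zero_mul, zero_add, add_pow_nine_of_three_eq_zero h3]
    ring
  · simp only [invTen, map_sub, map_mul, map_pow, polyAct_blockMat_X_one, polyAct_blockMat_X_two]
    simp only [C_1, C_0, one_mul, zero_mul, add_zero, add_pow_nine_of_three_eq_zero h3]
    have hb9 : (C β : MvPolynomial (Fin 3) F) ^ 9 = C β := by
      rw [show 9 = 2 * 4 + 1 from rfl, pow_succ, pow_mul, hb]; ring
    rw [mul_pow, hb9]
    ring

theorem invTwelve_eq_left [CharP F 3] : invTwelve F = (X 1 ^ 3 - X 1 * X 2 ^ 2) ^ 4 -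
    (X 1 ^ 3 - X 1 * X 2 ^ 2) ^ 2 * X 2 ^ 6 - X 2 ^ 12 := by
  rw [invTwelve]
  linear_combination (X 1 ^ 10 * X 2 ^ 2 - 2 * X 1 ^ 8 * X 2 ^ 4 + 2 * X 1 ^ 6 * X 2 ^ 6 -
    X 1 ^ 4 * X 2 ^ 8) * three_eq_zero_mvPolynomial F

theorem invTwelve_eq_right [CharP F 3] : invTwelve F = X 1 ^ 12 -
    (X 2 ^ 3 + X 2 * X 1 ^ 2) ^ 2 * X 1 ^ 6 - (X 2 ^ 3 + X 2 * X 1 ^ 2) ^ 4 := by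
  rw [invTwelve]
  linear_combination (X 1 ^ 2 * X 2 ^ 10 + 2 * X 1 ^ 4 * X 2 ^ 8 + 2 * X 1 ^ 6 * X 2 ^ 6 +
    X 1 ^ 8 * X 2 ^ 4) * three_eq_zero_mvPolynomial F

theorem fixedBySL_invTwelve [CharP F 3] {β : F} (hβ : β ^ 2 = -1) :
    FixedBySL β (invTwelve F) := by
  have h3 := three_eq_zero_mvPolynomial F
  have hb : (C β : MvPolynomial (Fin 3) F) ^ 2 = -1 := by rw [← C_pow, hβ]; simp
  constructor
  · rw [invTwelve_eq_left]
    simp only [map_sub, map_mul, map_pow, polyAct_blockMat_X_one, polyAct_blockMat_X_two]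
    simp only [C_1, C_0, one_mul, zero_mul, zero_add, add_pow_three_of_three_eq_zero h3]
    ring
  · rw [invTwelve_eq_right]
    simp only [map_add, map_sub, map_mul, map_pow, polyAct_blockMat_X_one, polyAct_blockMat_X_two]
    simp only [C_1, C_0, one_mul, zero_mul, add_zero, add_pow_three_of_three_eq_zero h3]
    have hb3 : (C β : MvPolynomial (Fin 3) F) ^ 3 = -C β := by rw [pow_succ, hb]; ring
    rw [mul_pow, hb3]
    ring

theorem FixedBySL.polyAct_diagonal [CharP F 3] {β : F} (hβ : β ^ 2 = -1) {p : MvPolynomial (Fin 3) F}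
    (hp : FixedBySL β p) : polyAct (diagonal ![1, β, -β]) p = p := by
  have h3 := three_eq_zero F
  obtain ⟨hA, hB⟩ := hp
  have e : diagonal ![1, β, -β] = blockMat 1 1 0 1 * blockMat 1 0 β 1 *
      (blockMat 1 1 0 1 * blockMat 1 1 0 1 * (blockMat 1 0 β 1 * blockMat 1 0 β 1)) *
      (blockMat 1 1 0 1 * blockMat 1 0 β 1) := by
    simp only [blockMat_mul]
    ext i j
    fin_cases i <;> fin_cases j <;> simp [blockMat]
    · linear_combination -(13 + 4 * β) * hβ - (-4 + 2 * β) * h3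
    · linear_combination -4 * hβ - 3 * β * h3
    · linear_combination -(9 + 4 * β) * hβ + 3 * h3
    · linear_combination -4 * hβ - (-1 + 2 * β) * h3
  rw [e]
  simp only [polyAct_mul, hA, hB]

end

section

variable {F : Type u} [Field F]

theorem X_two_dvd_iff (f : MvPolynomial (Fin 3) F) :
    X 2 ∣ f ↔ polyAct (diagonal ![1, 1, 0]) f = 0 := by
  constructor
  · rintro ⟨g, rfl⟩
    rw [map_mul, polyAct_X]
    simp [Fin.sum_univ_three]
  · intro h
    rw [← Ideal.mem_span_singleton, ← Set.image_singleton, mem_ideal_span_X_image]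
    refine fun m hm => ⟨2, rfl, fun h2 => mem_support_iff.1 hm ?_⟩
    have := congrArg (coeff m) h
    rw [coeff_polyAct_diagonal] at this
    simpa [Fin.prod_univ_three, h2] using this

theorem polyAct_diagonal_X_zero : polyAct (diagonal ![1, 1, (0 : F)]) (X 0) = X 0 := by
  rw [polyAct_X]; simp [Fin.sum_univ_three]

theorem polyAct_diagonal_X_one : polyAct (diagonal ![1, 1, (0 : F)]) (X 1) = X 1 := by
  rw [polyAct_X]; simp [Fin.sum_univ_three]

theorem polyAct_diagonal_X_two : polyAct (diagonal ![1, 1, (0 : F)]) (X 2) = 0 := by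
  rw [polyAct_X]; simp [Fin.sum_univ_three]

theorem polyAct_diagonal_invTwelve :
    polyAct (diagonal ![1, 1, (0 : F)]) (invTwelve F) = X 1 ^ 12 := by
  simp [invTwelve, polyAct_diagonal_X_one, polyAct_diagonal_X_two]

theorem polyAct_diagonal_invTen :
    polyAct (diagonal ![1, 1, (0 : F)]) (invTen F) = 0 := by
  simp [invTen, polyAct_diagonal_X_one, polyAct_diagonal_X_two]

theorem pderiv_two_polyAct_blockMat (p : MvPolynomial (Fin 3) F) :
    pderiv 2 (polyAct (blockMat 1 1 0 1) p) =
      polyAct (blockMat 1 1 0 1) (pderiv 1 p) + polyAct (blockMat 1 1 0 1) (pderiv 2 p) := by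
  induction p using MvPolynomial.induction_on with
  | C a =>
    rw [show polyAct (blockMat 1 1 0 1) (C a) = C a from (polyAct _).commutes a]
    simp
  | add p q hp hq => simp only [map_add, hp, hq]; ring
  | mul_X p i hp =>
    simp only [map_mul, Derivation.leibniz, hp, smul_eq_mul, map_add]
    fin_cases i
    · simp [polyAct_blockMat_X_zero, pderiv_X]; ring
    · simp [polyAct_blockMat_X_one, pderiv_X]; ring
    · simp [polyAct_blockMat_X_two, pderiv_X]; ring

theorem FixedBySL.twelve_dvd [CharP F 3] {β : F} (hβ : β ^ 2 = -1) {p : MvPolynomial (Fin 3) F}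
    (hp : FixedBySL β p) {m : Fin 3 →₀ ℕ} (hm : coeff m p ≠ 0) (h2 : m 2 = 0) : 12 ∣ m 1 := by
  have h3 := three_eq_zero F
  have h4 : 4 ∣ m 1 := by
    have h := congrArg (coeff m) (hp.polyAct_diagonal hβ)
    rw [coeff_polyAct_diagonal] at h
    have h1 : β ^ m 1 = 1 := by
      simpa [Fin.prod_univ_three, h2, hm] using h
    have : orderOf β = 2 ^ (1 + 1) := by
      apply orderOf_eq_prime_pow
      · rw [pow_one, hβ]
        intro h
        exact one_ne_zero (α := F) (by linear_combination h3 + h)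
      · rw [show 2 ^ (1 + 1) = 2 * 2 from rfl, pow_mul, hβ]; ring
    rw [show 4 = 2 ^ (1 + 1) from rfl, ← this]
    exact orderOf_dvd_of_pow_eq_one h1
  have h3 : 3 ∣ m 1 := by
    rcases Nat.eq_zero_or_pos (m 1) with h0 | h0
    · rw [h0]; exact dvd_zero _
    have hd := pderiv_two_polyAct_blockMat p
    rw [hp.1] at hd
    have e : ∀ f : MvPolynomial (Fin 3) F, polyAct (diagonal ![1, 1, 0])
        (polyAct (blockMat 1 1 0 1) f) = polyAct (diagonal ![1, 1, 0]) f := fun f => by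
      rw [← polyAct_mul]
      congr 1
      congr 1
      ext i j
      fin_cases i <;> fin_cases j <;> simp [blockMat, Matrix.mul_apply, Fin.sum_univ_three]
    have hd' := congrArg (polyAct (diagonal ![1, 1, 0])) hd
    rw [map_add, e, e, right_eq_add] at hd'
    have := congrArg (coeff (m - Finsupp.single 1 1)) hd'
    rw [coeff_polyAct_diagonal, coeff_pderiv, tsub_add_cancel_of_le] at this
    · rw [← CharP.cast_eq_zero_iff F 3]
      have hm1 : ((m 1 - 1 : ℕ) : F) + 1 = m 1 := by
        rw [← Nat.cast_succ, Nat.succ_eq_add_one, Nat.sub_add_cancel h0]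
      simpa [Fin.prod_univ_three, h2, hm, hm1] using this
    · rwa [Finsupp.single_le_iff]
  omega

/-- The substitution of `X 0` and the two basic invariants. -/
def basicInvMap (F : Type u) [Field F] : MvPolynomial (Fin 3) F →ₐ[F] MvPolynomial (Fin 3) F :=
  aeval ![X 0, invTen F, invTwelve F]

theorem totalDegree_invTwelve_le : (invTwelve F).totalDegree ≤ 12 := by
  have h (i j : ℕ) : (X 1 ^ i * X 2 ^ j : MvPolynomial (Fin 3) F).totalDegree ≤ i + j :=
    (totalDegree_mul _ _).trans (by rw [totalDegree_X_pow, totalDegree_X_pow])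
  unfold invTwelve
  refine (totalDegree_sub _ _).trans (max_le ?_ (by rw [totalDegree_X_pow]))
  refine (totalDegree_sub _ _).trans (max_le ?_ (h 2 10))
  refine (totalDegree_add _ _).trans (max_le ?_ (h 6 6))
  refine (totalDegree_sub _ _).trans (max_le ?_ (h 10 2))
  rw [totalDegree_X_pow]

theorem FixedBySL.exists_X_two_dvd_sub [CharP F 3] {β : F} (hβ : β ^ 2 = -1)
    {p : MvPolynomial (Fin 3) F} (hp : FixedBySL β p) :
    ∃ Q, (basicInvMap F Q).totalDegree ≤ p.totalDegree ∧ X 2 ∣ p - basicInvMap F Q := by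
  classical
  refine ⟨∑ m ∈ p.support with m 2 = 0, C (coeff m p) * X 0 ^ m 0 * X 2 ^ (m 1 / 12), ?_, ?_⟩
  · rw [map_sum]
    refine totalDegree_finsetSum_le fun m hm => ?_
    obtain ⟨hm, -⟩ := Finset.mem_filter.1 hm
    have h1 : basicInvMap F (C (coeff m p) * X 0 ^ m 0 * X 2 ^ (m 1 / 12)) =
        C (coeff m p) * X 0 ^ m 0 * invTwelve F ^ (m 1 / 12) := by
      simp [basicInvMap, algHom_C]
    rw [h1]
    refine (totalDegree_mul _ _).trans ?_
    have h2 := totalDegree_mul (C (coeff m p)) (X 0 ^ m 0 : MvPolynomial (Fin 3) F)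
    rw [totalDegree_C, totalDegree_X_pow] at h2
    have h3 := totalDegree_pow (invTwelve F) (m 1 / 12)
    have h4 := Nat.mul_le_mul_left (m 1 / 12) (totalDegree_invTwelve_le (F := F))
    have h5 := le_totalDegree hm
    rw [Finsupp.sum_fintype _ _ (by simp), Fin.sum_univ_three] at h5
    omega
  · rw [X_two_dvd_iff, map_sub, map_sum, map_sum, sub_eq_zero]
    have h1 : ∀ m ∈ p.support.filter (fun m => m 2 = 0), polyAct (diagonal ![1, 1, 0])
        (basicInvMap F (C (coeff m p) * X 0 ^ m 0 * X 2 ^ (m 1 / 12))) =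
        polyAct (diagonal ![1, 1, 0]) (monomial m (coeff m p)) := fun m hm => by
      obtain ⟨hm, h2⟩ := Finset.mem_filter.1 hm
      have h12 := hp.twelve_dvd hβ (mem_support_iff.1 hm) h2
      rw [monomial_eq, Finsupp.prod_fintype _ _ (by simp), Fin.prod_univ_three, h2]
      simp only [basicInvMap, map_mul, map_pow, aeval_X, algHom_C, polyAct_diagonal_X_zero,
        polyAct_diagonal_X_one, algebraMap_eq, Matrix.cons_val, polyAct_diagonal_invTwelve]
      rw [← pow_mul, Nat.mul_div_cancel' h12, pow_zero, mul_one, mul_assoc]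
    rw [Finset.sum_congr rfl h1, Finset.sum_filter]
    conv_lhs => rw [p.as_sum, map_sum]
    refine Finset.sum_congr rfl fun m _ => ?_
    split_ifs with h
    · rfl
    · rw [← X_two_dvd_iff]
      rw [monomial_eq, Finsupp.prod_fintype _ _ (by simp), Fin.prod_univ_three]
      exact dvd_mul_of_dvd_right (dvd_mul_of_dvd_right (dvd_pow_self _ h) _) _

end

section

variable {F : Type u} [Field F]

theorem isRelPrime_X_one_X_two : IsRelPrime (X 1 : MvPolynomial (Fin 3) F) (X 2) := by
  rw [Irreducible.isRelPrime_iff_not_dvd X_prime.irreducible, X_dvd_X]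
  decide

/-- The linear form `X 1 + c X 2`. -/
def linForm (c : F) : MvPolynomial (Fin 3) F := X 1 + C c * X 2

theorem isRelPrime_linForm_X_two (c : F) : IsRelPrime (linForm c) (X 2) := fun _ h1 h2 =>
  isRelPrime_X_one_X_two ((dvd_add_left (h2.mul_left _)).1 h1) h2

theorem isRelPrime_linForm {c d : F} (h : c ≠ d) : IsRelPrime (linForm c) (linForm d) :=
  fun e h1 h2 => by
    refine isRelPrime_linForm_X_two c h1 ?_
    have h3 : e ∣ C (c - d)⁻¹ * (linForm c - linForm d) := (dvd_sub h1 h2).mul_left _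
    have h4 : C (c - d)⁻¹ * (linForm c - linForm d) = X 2 := by
      rw [linForm, linForm, show X 1 + C c * X 2 - (X 1 + C d * X 2) =
        C (c - d) * (X 2 : MvPolynomial (Fin 3) F) by rw [C_sub]; ring, ← mul_assoc, ← C_mul,
        inv_mul_cancel₀ (sub_ne_zero.2 h), C_1, one_mul]
    rwa [h4] at h3

theorem FixedBySL.linForm_succ {β c : F} {f : MvPolynomial (Fin 3) F} (hf : FixedBySL β f)
    (h : linForm c ∣ f) : linForm (c + 1) ∣ f := by
  have := map_dvd (polyAct (blockMat 1 1 0 1)) h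
  rw [hf.1] at this
  convert this using 1
  simp only [linForm, map_add, map_mul, polyAct_blockMat_X_one, polyAct_blockMat_X_two, algHom_C,
    algebraMap_eq, C_1, C_0]
  ring

theorem FixedBySL.linForm_of_mul_eq {β c d : F} {f : MvPolynomial (Fin 3) F} (hf : FixedBySL β f)
    (h : linForm c ∣ f) (hd : d * (1 + c * β) = c) : linForm d ∣ f := by
  have := map_dvd (polyAct (blockMat 1 0 β 1)) h
  rw [hf.2] at this
  have e : polyAct (blockMat 1 0 β 1) (linForm c) = C (1 + c * β) * linForm d := by
    simp only [linForm, map_add, map_mul, polyAct_blockMat_X_one, polyAct_blockMat_X_two, algHom_C,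
      algebraMap_eq, C_1, C_0]
    have : C c = C d * (1 + C c * C β : MvPolynomial (Fin 3) F) := by
      rw [← C_mul, ← C_1, ← C_add, ← C_mul, hd]
    linear_combination X 2 * this
  rw [e] at this
  exact (dvd_mul_left _ _).trans this

theorem FixedBySL.linForm_of_X_two {β : F} (hβ : β ^ 2 = -1) {f : MvPolynomial (Fin 3) F}
    (hf : FixedBySL β f) (h : X 2 ∣ f) : linForm (-β) ∣ f := by
  have := map_dvd (polyAct (blockMat 1 0 β 1)) h
  rw [hf.2] at this
  have e : polyAct (blockMat 1 0 β 1) (X 2) = C β * linForm (-β) := by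
    have hb : (C β : MvPolynomial (Fin 3) F) ^ 2 = -1 := by rw [← C_pow, hβ]; simp
    simp only [linForm, polyAct_blockMat_X_two, C_1, C_neg]
    linear_combination X 2 * hb
  rw [e] at this
  exact (dvd_mul_left _ _).trans this

theorem FixedBySL.linForm_dvd [CharP F 3] {β : F} (hβ : β ^ 2 = -1) {f : MvPolynomial (Fin 3) F}
    (hf : FixedBySL β f) (h : X 2 ∣ f) (i : Fin 3 × Fin 3) :
    linForm ((i.1 : ℕ) + (i.2 : ℕ) * β) ∣ f := by
  have h3 := three_eq_zero F
  have key : ∀ c : F, linForm c ∣ f → ∀ k : Fin 3, linForm ((k : ℕ) + c) ∣ f := fun c hc k => by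
    fin_cases k
    · simpa using hc
    · simpa [add_comm] using hf.linForm_succ hc
    · have := hf.linForm_succ (hf.linForm_succ hc)
      simpa [add_comm, add_left_comm, ← add_assoc, one_add_one_eq_two] using this
  have a2 := hf.linForm_of_X_two hβ h
  have a1 : linForm β ∣ f := hf.linForm_of_mul_eq a2
    (by linear_combination -β * hβ + β * h3)
  have a0 : linForm (-1 : F) ∣ f := by
    refine hf.linForm_of_mul_eq (hf.linForm_succ a2) ?_
    linear_combination hβ - h3
  obtain ⟨i, j⟩ := i
  fin_cases j
  · have := key 0 (by simpa using hf.linForm_succ a0) i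
    simpa using this
  · simpa using key _ a1 i
  · have e : (2 : F) * β = -β := by linear_combination β * h3
    simpa [e] using key _ a2 i

theorem prod_linForm [CharP F 3] {β : F} (hβ : β ^ 2 = -1) :
    ∏ i : Fin 3 × Fin 3, linForm ((i.1 : ℕ) + (i.2 : ℕ) * β : F) = X 1 ^ 9 - X 1 * X 2 ^ 8 := by
  have h3 := three_eq_zero_mvPolynomial F
  have hb : (C β : MvPolynomial (Fin 3) F) ^ 2 = -1 := by rw [← C_pow, hβ]; simp
  have hC : (C 2 : MvPolynomial (Fin 3) F) = 2 := map_ofNat C 2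
  have h1 (c : F) : ∏ i : Fin 3, linForm ((i : ℕ) + c) = linForm c ^ 3 - linForm c * X 2 ^ 2 := by
    simp only [Fin.prod_univ_three, linForm, C_add]
    simp [hC]
    generalize C c = b
    linear_combination ((X 1 + b * X 2) ^ 2 * X 2 + (X 1 + b * X 2) * X 2 ^ 2) * h3
  rw [Fintype.prod_prod_type_right]
  simp only [h1]
  simp only [Fin.prod_univ_three, linForm]
  simp [hC]
  generalize C β = b at *
  have e1 : (X 1 + b * X 2) ^ 3 - (X 1 + b * X 2) * X 2 ^ 2 =
      X 1 ^ 3 - X 1 * X 2 ^ 2 + b * X 2 ^ 3 := by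
    linear_combination (b * X 2 ^ 3) * hb + (X 1 ^ 2 * b * X 2 + X 1 * b ^ 2 * X 2 ^ 2 - b * X 2 ^ 3) * h3
  have e2 : (X 1 + 2 * b * X 2) ^ 3 - (X 1 + 2 * b * X 2) * X 2 ^ 2 =
      X 1 ^ 3 - X 1 * X 2 ^ 2 - b * X 2 ^ 3 := by
    linear_combination (8 * b * X 2 ^ 3) * hb +
      (2 * X 1 ^ 2 * b * X 2 + 4 * X 1 * b ^ 2 * X 2 ^ 2 - 3 * b * X 2 ^ 3) * h3
  rw [e1, e2]
  generalize (X 1 : MvPolynomial (Fin 3) F) = x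
  generalize (X 2 : MvPolynomial (Fin 3) F) = y
  linear_combination (-(x ^ 3 - x * y ^ 2) * y ^ 6) * hb + (-x ^ 7 * y ^ 2 + x ^ 5 * y ^ 4) * h3

theorem injective_add_mul [CharP F 3] {β : F} (hβ : β ^ 2 = -1) :
    Function.Injective fun i : Fin 3 × Fin 3 => ((i.1 : ℕ) + (i.2 : ℕ) * β : F) := by
  have h3 := three_eq_zero F
  have h1 : (1 : F) ≠ 0 := one_ne_zero
  rintro ⟨i, j⟩ ⟨k, l⟩ h
  fin_cases i <;> fin_cases j <;> fin_cases k <;> fin_cases l <;> simp at h ⊢ <;> grind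

theorem FixedBySL.invTen_dvd [CharP F 3] {β : F} (hβ : β ^ 2 = -1) {f : MvPolynomial (Fin 3) F}
    (hf : FixedBySL β f) (h : X 2 ∣ f) : invTen F ∣ f := by
  have h3 := three_eq_zero F
  have h9 : ∏ i : Fin 3 × Fin 3, linForm ((i.1 : ℕ) + (i.2 : ℕ) * β : F) ∣ f := by
    refine Fintype.prod_dvd_of_isRelPrime (fun i j hij => isRelPrime_linForm fun h => hij ?_)
      (hf.linForm_dvd hβ h)
    exact injective_add_mul hβ h
  have h10 : (∏ i : Fin 3 × Fin 3, linForm ((i.1 : ℕ) + (i.2 : ℕ) * β : F)) * X 2 ∣ f :=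
    (IsRelPrime.prod_left fun i _ => isRelPrime_linForm_X_two _).mul_dvd h9 h
  rw [prod_linForm hβ] at h10
  rw [← neg_dvd]
  convert h10 using 1
  rw [invTen]
  ring

theorem invTen_ne_zero : invTen F ≠ 0 := fun h => by
  have := congrArg (coeff (Finsupp.single 1 1 + Finsupp.single 2 9)) h
  have h1 : (X 1 * X 2 ^ 9 : MvPolynomial (Fin 3) F) = monomial (Finsupp.single 1 1 + Finsupp.single 2 9) 1 := by
    rw [X_pow_eq_monomial, X, monomial_mul, one_mul]
  have h2 : (X 1 ^ 9 * X 2 : MvPolynomial (Fin 3) F) = monomial (Finsupp.single 1 9 + Finsupp.single 2 1) 1 := by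
    rw [X_pow_eq_monomial, X, monomial_mul, one_mul]
  rw [invTen, h1, h2, coeff_sub, coeff_monomial, coeff_monomial, if_pos rfl, if_neg] at this
  · simp at this
  · intro h
    have := DFunLike.congr_fun h 1
    simp at this

theorem fixedBySL_basicInvMap [CharP F 3] {β : F} (hβ : β ^ 2 = -1)
    (Q : MvPolynomial (Fin 3) F) : FixedBySL β (basicInvMap F Q) := by
  have (M : Matrix (Fin 3) (Fin 3) F) (h0 : polyAct M (X 0) = X 0)
      (h1 : polyAct M (invTen F) = invTen F) (h2 : polyAct M (invTwelve F) = invTwelve F) :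
      polyAct M (basicInvMap F Q) = basicInvMap F Q := by
    have : (polyAct M).comp (basicInvMap F) = basicInvMap F := by
      ext1 i
      fin_cases i <;> simp [basicInvMap, h0, h1, h2]
    exact DFunLike.congr_fun this Q
  have h1 := fixedBySL_invTen hβ
  have h2 := fixedBySL_invTwelve hβ
  have h0 := fixedBySL_X_zero β
  exact ⟨this _ h0.1 h1.1 h2.1, this _ h0.2 h1.2 h2.2⟩

theorem FixedBySL.exists_basicInvMap_eq [CharP F 3] {β : F} (hβ : β ^ 2 = -1)
    {p : MvPolynomial (Fin 3) F} (hp : FixedBySL β p) : ∃ Q, basicInvMap F Q = p := by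
  induction hn : p.totalDegree using Nat.strong_induction_on generalizing p with
  | _ n ih =>
    obtain ⟨Q, hQ, hd⟩ := hp.exists_X_two_dvd_sub hβ
    have hfix := fixedBySL_basicInvMap (F := F) hβ
    have hf : FixedBySL β (p - basicInvMap F Q) :=
      ⟨by rw [map_sub, hp.1, (hfix Q).1], by rw [map_sub, hp.2, (hfix Q).2]⟩
    obtain ⟨g, hg⟩ := hf.invTen_dvd hβ hd
    by_cases hg0 : g = 0
    · exact ⟨Q, by rw [hg0, mul_zero, sub_eq_zero] at hg; exact hg.symm⟩
    have hL := fixedBySL_invTen hβ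
    have hgf : FixedBySL β g := by
      rw [hg] at hf
      exact ⟨mul_left_cancel₀ invTen_ne_zero (by conv_rhs => rw [← hf.1, map_mul, hL.1]),
        mul_left_cancel₀ invTen_ne_zero (by conv_rhs => rw [← hf.2, map_mul, hL.2])⟩
    have hdeg : g.totalDegree < n := by
      have h1 := totalDegree_mul_of_isDomain invTen_ne_zero hg0
      rw [← hg] at h1
      have h2 := totalDegree_sub p (basicInvMap F Q)
      have h3 : 0 < (invTen F).totalDegree := by
        rw [Nat.pos_iff_ne_zero]
        intro h
        rw [totalDegree_eq_zero_iff_eq_C] at h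
        have h4 := polyAct_diagonal_invTen (F := F)
        rw [h, algHom_C, algebraMap_eq] at h4
        exact invTen_ne_zero (h.trans h4)
      have h5 := max_le le_rfl hQ
      omega
    obtain ⟨Q', hQ'⟩ := ih _ hdeg hgf rfl
    refine ⟨Q + X 1 * Q', ?_⟩
    rw [map_add, map_mul, hQ', show basicInvMap F (X 1) = invTen F by simp [basicInvMap], ← hg]
    ring

theorem coeff_aeval_pow_twelve (P : MvPolynomial (Fin 3) F) {m : Fin 3 →₀ ℕ} (hm : m 1 = 0) :
    coeff (Finsupp.single 0 (m 0) + Finsupp.single 1 (12 * m 2))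
      (aeval ![X 0, 0, X 1 ^ 12] P : MvPolynomial (Fin 3) F) = coeff m P := by
  classical
  induction P using MvPolynomial.induction_on' with
  | monomial k a =>
    rw [aeval_monomial, Finsupp.prod_fintype _ _ (by simp), Fin.prod_univ_three, coeff_monomial]
    simp only [cons_val_zero, cons_val_one, cons_val, algebraMap_eq]
    by_cases hk : k 1 = 0
    · rw [hk, pow_zero, mul_one, ← pow_mul, X_pow_eq_monomial, X_pow_eq_monomial, monomial_mul,
        C_mul_monomial, coeff_monomial, mul_one, mul_one]
      refine if_congr ⟨fun h => ?_, fun h => by rw [h]⟩ rfl rfl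
      have a0 := DFunLike.congr_fun h 0
      have a1 := DFunLike.congr_fun h 1
      simp at a0 a1
      ext i
      fin_cases i
      · exact a0
      · exact hk.trans hm.symm
      · exact a1
    · rw [zero_pow hk, mul_zero, zero_mul, mul_zero, coeff_zero, if_neg]
      rintro rfl
      exact hk hm
  | add p q hp hq => rw [map_add, coeff_add, hp, hq, coeff_add]

theorem basicInvMap_injective : Function.Injective (basicInvMap F) := by
  rw [injective_iff_map_eq_zero]
  intro P
  induction hn : P.totalDegree using Nat.strong_induction_on generalizing P with
  | _ n ih =>
    intro hP
    by_contra hP0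
    have hd : X 1 ∣ P := by
      rw [← Ideal.mem_span_singleton, ← Set.image_singleton, mem_ideal_span_X_image]
      refine fun m hm => ⟨1, rfl, fun h1 => mem_support_iff.1 hm ?_⟩
      have e : ((polyAct (diagonal ![1, 1, (0 : F)])).comp (basicInvMap F)) P = 0 := by
        rw [AlgHom.comp_apply, hP, map_zero]
      have e' : (polyAct (diagonal ![1, 1, (0 : F)])).comp (basicInvMap F) =
          aeval ![X 0, 0, X 1 ^ 12] := by
        ext1 i
        fin_cases i <;> simp [basicInvMap, polyAct_diagonal_invTen, polyAct_diagonal_invTwelve,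
          polyAct_diagonal_X_zero]
      rw [e'] at e
      rw [← coeff_aeval_pow_twelve P h1, e, coeff_zero]
    obtain ⟨P', rfl⟩ := hd
    have hP'0 : P' ≠ 0 := right_ne_zero_of_mul hP0
    rw [map_mul, show basicInvMap F (X 1) = invTen F by simp [basicInvMap]] at hP
    have h1 := totalDegree_mul_of_isDomain (X_ne_zero (R := F) (1 : Fin 3)) hP'0
    rw [totalDegree_X] at h1
    exact hP'0 (ih P'.totalDegree (by omega) P' rfl ((mul_eq_zero.1 hP).resolve_left invTen_ne_zero))

end

section

variable {F : Type u} [Field F]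

theorem polyAct_diagonal_basicInvMap (a c : F) (P : MvPolynomial (Fin 3) F) :
    polyAct (diagonal ![a, c, c]) (basicInvMap F P) =
      basicInvMap F (polyAct (diagonal ![a, c ^ 10, c ^ 12]) P) := by
  have hX (d : Fin 3 → F) (i : Fin 3) : polyAct (diagonal d) (X i) = C (d i) * X i := by
    rw [polyAct_X, Finset.sum_eq_single i]
    · rw [diagonal_apply_eq, smul_eq_C_mul]
    · intro j _ hj
      rw [diagonal_apply_ne _ hj.symm, zero_smul]
    · simp
  have : (polyAct (diagonal ![a, c, c])).comp (basicInvMap F) =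
      (basicInvMap F).comp (polyAct (diagonal ![a, c ^ 10, c ^ 12])) := by
    ext1 i
    fin_cases i
    · simp [basicInvMap, hX, algHom_C]
    · simp [basicInvMap, hX, algHom_C, invTen]
      ring
    · simp [basicInvMap, hX, algHom_C, invTwelve]
      ring
  exact DFunLike.congr_fun this P

theorem prod_pow_eq_zpow_expWeight {c : F} (hc : c ≠ 0) (m : Fin 3 →₀ ℕ) :
    ∏ i, ![(c ^ 2)⁻¹, c ^ 10, c ^ 12] i ^ m i = ((c ^ 2)⁻¹) ^ (-expWeight m) := by
  simp only [Fin.prod_univ_three, expWeight_apply, cons_val_zero, cons_val_one, cons_val,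
    ← zpow_natCast, ← _root_.zpow_neg, ← _root_.zpow_mul]
  rw [← zpow_add₀ hc, ← zpow_add₀ hc]
  congr 1
  push_cast
  ring

theorem map_basicInvMap_weightRing [CharP F 3] {β : F} (hβ : β ^ 2 = -1) {n : ℕ}
    {S : Set (Matrix (Fin 3) (Fin 3) F)} (h1 : blockMat 1 1 0 1 ∈ S) (h2 : blockMat 1 0 β 1 ∈ S)
    (hS : ∀ M ∈ S, ∃ c T, c ≠ 0 ∧ (∀ p, FixedBySL β p → polyAct T p = p) ∧
      M = diagonal ![(c ^ 2)⁻¹, c, c] * T ∧ M 0 0 = (c ^ 2)⁻¹)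
    (hn : ∀ z : ℤ, (n : ℤ) ∣ z ↔ ∀ M ∈ S, M 0 0 ^ z = 1) :
    (weightRing F n).map (basicInvMap F) = invariantAlg S := by
  have key (P : MvPolynomial (Fin 3) F) :
      basicInvMap F P ∈ invariantAlg S ↔ P ∈ weightRing F n := by
    change (∀ M ∈ S, polyAct M _ = _) ↔ ∀ m ∈ P.support, (n : ℤ) ∣ expWeight m
    have hMP : ∀ M ∈ S, polyAct M (basicInvMap F P) = basicInvMap F P ↔
        ∀ m ∈ P.support, M 0 0 ^ expWeight m = 1 := fun M hM => by
      obtain ⟨c, T, hc, hT, hMT, h00⟩ := hS M hM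
      rw [hMT, polyAct_mul, polyAct_diagonal_basicInvMap, hT _ (fixedBySL_basicInvMap hβ _),
        basicInvMap_injective.eq_iff, ← hMT, h00, MvPolynomial.ext_iff]
      refine forall_congr' fun m => ?_
      rw [coeff_polyAct_diagonal, prod_pow_eq_zpow_expWeight hc, mem_support_iff,
        mul_left_eq_self₀, _root_.zpow_neg, inv_eq_one]
      tauto
    rw [forall₂_congr hMP]
    simp only [hn]
    exact ⟨fun h m hm M hM => h M hM m hm, fun h M hM m hm => h m hm M hM⟩
  ext p
  rw [Subalgebra.mem_map]
  refine ⟨fun ⟨P, hP, e⟩ => e ▸ (key P).2 hP, fun hp => ?_⟩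
  obtain ⟨P, rfl⟩ := FixedBySL.exists_basicInvMap_eq hβ ⟨hp _ h1, hp _ h2⟩
  exact ⟨P, (key P).1 hp, rfl⟩

/-- Invariants of a set of matrices up to a change of coordinates. -/
theorem invariantAlg_conj {m : ℕ} (S : Set (Matrix (Fin m) (Fin m) F))
    (A : (Matrix (Fin m) (Fin m) F)ˣ) : Nonempty (invariantAlg S ≃+*
      invariantAlg {M | ∃ N ∈ S, (↑A⁻¹ : Matrix (Fin m) (Fin m) F) * N * (A : Matrix (Fin m) (Fin m) F) = M}) := by
  have hinj : Function.Injective (polyAct (A : Matrix (Fin m) (Fin m) F)) :=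
    Function.LeftInverse.injective (g := polyAct (↑A⁻¹ : Matrix (Fin m) (Fin m) F)) fun p => by
      rw [← polyAct_mul, A.mul_inv, polyAct_one]
  have e : (invariantAlg S).map (polyAct (A : Matrix (Fin m) (Fin m) F)) =
      invariantAlg {M | ∃ N ∈ S, (↑A⁻¹ : Matrix (Fin m) (Fin m) F) * N * (A : Matrix (Fin m) (Fin m) F) = M} := by
    ext q
    rw [Subalgebra.mem_map]
    constructor
    · rintro ⟨p, hp, rfl⟩ _ ⟨N, hN, rfl⟩
      rw [← RingHom.coe_coe]
      change polyAct _ (polyAct _ p) = polyAct _ p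
      rw [← polyAct_mul, mul_assoc, A.mul_inv_cancel_left, polyAct_mul, hp N hN]
    · intro hq
      refine ⟨polyAct (↑A⁻¹ : Matrix (Fin m) (Fin m) F) q, fun N hN => ?_, ?_⟩
      · have := hq _ ⟨N, hN, rfl⟩
        apply hinj
        rw [← polyAct_mul, ← polyAct_mul, ← polyAct_mul, A.inv_mul, polyAct_one, ← mul_assoc, this]
      · rw [← polyAct_mul, A.inv_mul, polyAct_one]
  rw [← e]
  exact ⟨((invariantAlg S).equivMapOfInjective _ hinj).toRingEquiv⟩

end

section

variable {F : Type u} [Field F]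

/-- The embedding `M ↦ 1 ⊕ M` of `2 × 2` matrices into `3 × 3` matrices. -/
def oneBlock : Matrix (Fin 2) (Fin 2) F →* Matrix (Fin 3) (Fin 3) F where
  toFun M := blockMat (M 0 0) (M 0 1) (M 1 0) (M 1 1)
  map_one' := by
    ext i j
    fin_cases i <;> fin_cases j <;> simp [blockMat]
  map_mul' M N := by simp [blockMat_mul, Matrix.mul_apply]

theorem oneBlock_apply (M : Matrix (Fin 2) (Fin 2) F) :
    oneBlock M = blockMat (M 0 0) (M 0 1) (M 1 0) (M 1 1) := rfl

theorem diagonal_mul_oneBlock (a c : F) (M : Matrix (Fin 2) (Fin 2) F) :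
    diagonal ![a, c, c] * oneBlock M = oneBlock M * diagonal ![a, c, c] := by
  ext i j
  fin_cases i <;> fin_cases j <;> simp [oneBlock_apply, blockMat, mul_comm]

theorem diagonal_mul_oneBlock_smul (a c : F) (M : Matrix (Fin 2) (Fin 2) F) :
    diagonal ![a, 1, 1] * oneBlock (c • M) = diagonal ![a, c, c] * oneBlock M := by
  ext i j
  fin_cases i <;> fin_cases j <;> simp [oneBlock_apply, blockMat]

theorem transSubgroup_le {m : ℕ} (G : Subgroup (SpecialLinearGroup (Fin m) F)) :
    transSubgroup G ≤ G :=
  (Subgroup.closure_le _).2 fun _ h => h.1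

theorem conj_mem_transSubgroup {m : ℕ} {G : Subgroup (SpecialLinearGroup (Fin m) F)}
    {g τ : SpecialLinearGroup (Fin m) F} (hg : g ∈ G) (hτ : τ ∈ transSubgroup G) :
    g * τ * g⁻¹ ∈ transSubgroup G := by
  induction hτ using Subgroup.closure_induction with
  | mem x hx =>
    refine Subgroup.subset_closure ⟨mul_mem (mul_mem hg hx.1) (inv_mem hg), ?_⟩
    have h1 : (g : Matrix (Fin m) (Fin m) F) * (g⁻¹ : SpecialLinearGroup (Fin m) F) = 1 := by
      rw [← Matrix.SpecialLinearGroup.coe_mul, mul_inv_cancel, Matrix.SpecialLinearGroup.coe_one]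
    have h2 : ((g⁻¹ : SpecialLinearGroup (Fin m) F) : Matrix (Fin m) (Fin m) F) * g = 1 := by
      rw [← Matrix.SpecialLinearGroup.coe_mul, inv_mul_cancel, Matrix.SpecialLinearGroup.coe_one]
    have e : ((g * x * g⁻¹ : SpecialLinearGroup (Fin m) F) : Matrix (Fin m) (Fin m) F) - 1 =
        (g : Matrix (Fin m) (Fin m) F) * (((x : Matrix (Fin m) (Fin m) F) - 1) *
          (g⁻¹ : SpecialLinearGroup (Fin m) F)) := by
      rw [Matrix.SpecialLinearGroup.coe_mul, Matrix.SpecialLinearGroup.coe_mul, sub_mul, mul_sub, one_mul, h1,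
        mul_assoc]
    refine ⟨?_, ?_⟩
    · rw [e, rank_mul_eq_right_of_isUnit_det, rank_mul_eq_left_of_isUnit_det, hx.2.1]
      · rw [Matrix.SpecialLinearGroup.det_coe]
        exact isUnit_one
      · rw [Matrix.SpecialLinearGroup.det_coe]
        exact isUnit_one
    · rw [e, mul_assoc, mul_assoc, ← mul_assoc (g⁻¹ : SpecialLinearGroup (Fin m) F).1, h2, one_mul,
        ← mul_assoc (_ - 1), hx.2.2, zero_mul, mul_zero]
  | one => rw [mul_one, mul_inv_cancel]; exact one_mem _
  | mul x y _ _ hx hy => convert mul_mem hx hy using 1; group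
  | inv x _ hx => convert inv_mem hx using 1; group

/-- `g` preserves the decomposition of `F³` into the first coordinate axis and the coordinate
plane spanned by the other two. -/
def IsBlock (g : SpecialLinearGroup (Fin 3) F) : Prop :=
  (g : Matrix (Fin 3) (Fin 3) F) 0 1 = 0 ∧ (g : Matrix (Fin 3) (Fin 3) F) 0 2 = 0 ∧
    (g : Matrix (Fin 3) (Fin 3) F) 1 0 = 0 ∧ (g : Matrix (Fin 3) (Fin 3) F) 2 0 = 0

variable {g h : SpecialLinearGroup (Fin 3) F}

theorem IsBlock.coe_eq (hg : IsBlock g) :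
    (g : Matrix (Fin 3) (Fin 3) F) = diagonal ![g 0 0, 1, 1] * oneBlock (subW g) := by
  obtain ⟨h1, h2, h3, h4⟩ := hg
  ext i j
  fin_cases i <;> fin_cases j <;> simp [oneBlock_apply, blockMat, subW, *]

theorem IsBlock.mul_apply_zero (hg : IsBlock g) (h : SpecialLinearGroup (Fin 3) F) :
    (g * h) 0 0 = g 0 0 * h 0 0 := by
  obtain ⟨h1, h2, h3, h4⟩ := hg
  rw [Matrix.SpecialLinearGroup.coe_mul, Matrix.mul_apply, Fin.sum_univ_three, h1, h2]
  ring

theorem IsBlock.restrictW_mul (hg : IsBlock g) (P : (Matrix (Fin 2) (Fin 2) F)ˣ)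
    (h : SpecialLinearGroup (Fin 3) F) :
    restrictW P (g * h) = restrictW P g * restrictW P h := by
  have e : subW (g * h) = subW g * subW h := by
    obtain ⟨h1, h2, h3, h4⟩ := hg
    ext i j
    fin_cases i <;> fin_cases j <;>
      simp [subW, Matrix.mul_apply, Fin.sum_univ_three, h3, h4]
  rw [restrictW, restrictW, restrictW, e]
  simp only [mul_assoc, Units.mul_inv_cancel_left]

theorem IsBlock.apply_mul_det_restrictW (hg : IsBlock g) (P : (Matrix (Fin 2) (Fin 2) F)ˣ) :
    g 0 0 * (restrictW P g).det = 1 := by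
  have h1 : (restrictW P g).det = (subW g).det := by
    rw [restrictW, mul_assoc, det_mul_comm, mul_assoc, P.mul_inv, mul_one]
  have h2 := g.det_coe
  rw [hg.coe_eq, det_mul, det_diagonal, Fin.prod_univ_three, oneBlock_apply, blockMat] at h2
  rw [h1, det_fin_two]
  simpa [det_fin_three] using h2

end

section

variable {F : Type u} [Field F] {G : Subgroup (SpecialLinearGroup (Fin 3) F)}

theorem apply_zero_zero_eq (hG : ∀ g ∈ G, IsBlock g) {P : (Matrix (Fin 2) (Fin 2) F)ˣ}
    {g τ : SpecialLinearGroup (Fin 3) F} {c : F} (hg : g ∈ G) (hτ : (restrictW P τ).det = 1)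
    (h : restrictW P g = c • restrictW P τ) : g 0 0 = (c ^ 2)⁻¹ := by
  have := (hG g hg).apply_mul_det_restrictW P
  rw [h, det_smul, hτ, mul_one, Fintype.card_fin] at this
  exact eq_inv_of_mul_eq_one_left this

theorem exists_restrictW_eq_smul [CharP F 3] (hG : ∀ g ∈ G, IsBlock g)
    {P : (Matrix (Fin 2) (Fin 2) F)ˣ}
    {φ : SpecialLinearGroup (Fin 2) (ZMod 5) →* Matrix (Fin 2) (Fin 2) F}
    (hφ : Function.Injective φ)
    (hr : Set.range φ = {M | ∃ τ ∈ transSubgroup G, restrictW P τ = M})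
    {g : SpecialLinearGroup (Fin 3) F} (hg : g ∈ G) :
    ∃ y, ∃ c : F, restrictW P g = c • φ y := by
  have hdet : IsUnit (restrictW P g) := by
    rw [Matrix.isUnit_iff_isUnit_det]
    exact (IsUnit.of_mul_eq_one_right _ ((hG g hg).apply_mul_det_restrictW P))
  obtain ⟨M, hM⟩ := hdet
  rw [← hM]
  refine eq_smul_of_normalizes hφ M fun x => ?_
  obtain ⟨τ, hτ, e⟩ : φ x ∈ {M | ∃ τ ∈ transSubgroup G, restrictW P τ = M} := hr ▸ ⟨x, rfl⟩
  have h1 := conj_mem_transSubgroup hg hτ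
  obtain ⟨y, hy⟩ : restrictW P (g * τ * g⁻¹) ∈ Set.range φ := hr ▸ ⟨_, h1, rfl⟩
  refine ⟨y, ?_⟩
  rw [hM, hy, ← e, ← (hG _ hg).restrictW_mul, ← (hG _ (transSubgroup_le G h1)).restrictW_mul,
    inv_mul_cancel_right]

theorem FixedBySL.polyAct_oneBlock {β : F}
    {ψ : SpecialLinearGroup (Fin 2) (ZMod 5) →* Matrix (Fin 2) (Fin 2) F}
    (hA : ψ slA = !![1, 1; 0, 1]) (hB : ψ slB = !![1, 0; β, 1]) {p : MvPolynomial (Fin 3) F}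
    (hp : FixedBySL β p) (y : SpecialLinearGroup (Fin 2) (ZMod 5)) :
    polyAct (oneBlock (ψ y)) p = p := by
  have hy : y ∈ Subgroup.closure {slA, slB} := closure_slA_slB ▸ Subgroup.mem_top y
  induction hy using Subgroup.closure_induction with
  | mem x hx =>
    obtain rfl | rfl := hx
    · simpa [hA, oneBlock_apply] using hp.1
    · simpa [hB, oneBlock_apply] using hp.2
  | one => rw [map_one, map_one, polyAct_one]
  | mul x y _ _ hx hy => rw [map_mul, map_mul, polyAct_mul, hx, hy]
  | inv x _ hx =>
    conv_lhs => rw [← hx]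
    rw [← polyAct_mul, ← map_mul, ← map_mul, mul_inv_cancel, map_one, map_one, polyAct_one]

theorem exists_dvd_iff_zpow_eq_one [Finite G] (hG : ∀ g ∈ G, IsBlock g) :
    ∃ n : ℕ, n ≠ 0 ∧ ∀ z : ℤ, (n : ℤ) ∣ z ↔ ∀ g ∈ G, g 0 0 ^ z = 1 := by
  let χ : G →* F :=
    { toFun := fun g => g.1 0 0
      map_one' := by simp
      map_mul' := fun g h => (hG g g.2).mul_apply_zero h }
  have h0 (g : G) : χ g ≠ 0 := ((Group.isUnit g).map χ).ne_zero
  let K : AddSubgroup ℤ :=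
    { carrier := {z | ∀ g : G, χ g ^ z = 1}
      zero_mem' := fun g => zpow_zero _
      add_mem' := fun {a b} ha hb g => by rw [zpow_add₀ (h0 g), ha g, hb g, one_mul]
      neg_mem' := fun {a} ha g => by rw [_root_.zpow_neg, ha g, inv_one] }
  obtain ⟨a, ha⟩ := Int.subgroup_cyclic K
  rw [← AddSubgroup.zmultiples_eq_closure] at ha
  have hK : ∀ z : ℤ, (a.natAbs : ℤ) ∣ z ↔ ∀ g ∈ G, g 0 0 ^ z = 1 := fun z => by
    rw [Int.natAbs_dvd, ← Int.mem_zmultiples_iff, ← ha]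
    exact ⟨fun h g hg => h ⟨g, hg⟩, fun h g => h g.1 g.2⟩
  refine ⟨a.natAbs, fun h => ?_, hK⟩
  have h1 : (a.natAbs : ℤ) ∣ Nat.card G := (hK _).2 fun g hg => by
    change χ ⟨g, hg⟩ ^ _ = 1
    rw [zpow_natCast, ← map_pow, pow_card_eq_one', map_one]
  rw [h, Nat.cast_zero, zero_dvd_iff, Nat.cast_eq_zero] at h1
  exact Nat.card_pos.ne' h1

theorem nonempty_invariantRing_equiv [CharP F 3] (hG : ∀ g ∈ G, IsBlock g)
    {P : (Matrix (Fin 2) (Fin 2) F)ˣ}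
    {φ : SpecialLinearGroup (Fin 2) (ZMod 5) →* Matrix (Fin 2) (Fin 2) F}
    (hφ : Function.Injective φ)
    (hr : Set.range φ = {M | ∃ τ ∈ transSubgroup G, restrictW P τ = M})
    {n : ℕ} (hn : ∀ z : ℤ, (n : ℤ) ∣ z ↔ ∀ g ∈ G, g 0 0 ^ z = 1) :
    Nonempty (invariantRing G ≃+* weightRing F n) := by
  obtain ⟨Q, β, hβ, hA, hB⟩ := exists_sl_two_five_normal_form hφ
  let ψ : SpecialLinearGroup (Fin 2) (ZMod 5) →* Matrix (Fin 2) (Fin 2) F :=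
    { toFun := fun y => (↑Q⁻¹ : Matrix (Fin 2) (Fin 2) F) * φ y * (Q : Matrix (Fin 2) (Fin 2) F)
      map_one' := by simp
      map_mul' := fun x y => by simp only [map_mul, mul_assoc, Units.mul_inv_cancel_left] }
  have hψA : ψ slA = !![1, 1; 0, 1] := by
    change _ * φ slA * _ = _
    rw [mul_assoc, hA, Units.inv_mul_cancel_left]
  have hψB : ψ slB = !![1, 0; β, 1] := by
    change _ * φ slB * _ = _
    rw [mul_assoc, hB, Units.inv_mul_cancel_left]
  let A := Units.map (oneBlock (F := F)) (P * Q)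
  have hconj : ∀ g ∈ G, ∀ y c, restrictW P g = c • φ y →
      g 0 0 = (c ^ 2)⁻¹ ∧ (↑A⁻¹ : Matrix (Fin 3) (Fin 3) F) * g.1 * (A : Matrix (Fin 3) (Fin 3) F) =
        diagonal ![(c ^ 2)⁻¹, c, c] * oneBlock (ψ y) := fun g hg y c h => by
    have h0 := (hG g hg).apply_mul_det_restrictW P
    rw [h, det_smul, det_sl_two_five_hom, mul_one, Fintype.card_fin] at h0
    have h00 := eq_inv_of_mul_eq_one_left h0
    refine ⟨h00, ?_⟩
    have hR : (↑(P * Q)⁻¹ : Matrix (Fin 2) (Fin 2) F) * subW g * (P * Q : (Matrix (Fin 2) (Fin 2) F)ˣ) =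
        c • ψ y := by
      change _ = c • (_ * φ y * _)
      rw [← smul_mul_assoc, ← mul_smul_comm, ← h, restrictW, _root_.mul_inv_rev]
      simp only [Units.val_mul, mul_assoc]
    rw [← diagonal_mul_oneBlock_smul, ← hR, map_mul, map_mul, (hG g hg).coe_eq, ← h00]
    change oneBlock (↑(P * Q)⁻¹ : Matrix (Fin 2) (Fin 2) F) * _ * oneBlock _ = _
    rw [← mul_assoc, ← mul_assoc, ← mul_assoc, diagonal_mul_oneBlock, mul_assoc _ (diagonal _),
      diagonal_mul_oneBlock, ← mul_assoc]
  obtain ⟨e⟩ := invariantAlg_conj {M | ∃ g ∈ G, (g : Matrix (Fin 3) (Fin 3) F) = M} A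
  have hmem (x : SpecialLinearGroup (Fin 2) (ZMod 5)) : oneBlock (ψ x) ∈
      {M | ∃ N ∈ {M | ∃ g ∈ G, (g : Matrix (Fin 3) (Fin 3) F) = M},
        (↑A⁻¹ : Matrix (Fin 3) (Fin 3) F) * N * (A : Matrix (Fin 3) (Fin 3) F) = M} := by
    obtain ⟨τ, hτ, h⟩ : φ x ∈ {M | ∃ τ ∈ transSubgroup G, restrictW P τ = M} := hr ▸ ⟨x, rfl⟩
    have := (hconj τ (transSubgroup_le G hτ) x 1 (by rw [h, one_smul])).2
    refine ⟨_, ⟨τ, transSubgroup_le G hτ, rfl⟩, this.trans ?_⟩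
    have h1 : diagonal ![((1 : F) ^ 2)⁻¹, 1, 1] = (1 : Matrix (Fin 3) (Fin 3) F) := by
      ext i j
      fin_cases i <;> fin_cases j <;> simp
    rw [h1, one_mul]
  have hmap := map_basicInvMap_weightRing hβ (n := n)
    (S := {M | ∃ N ∈ {M | ∃ g ∈ G, (g : Matrix (Fin 3) (Fin 3) F) = M},
        (↑A⁻¹ : Matrix (Fin 3) (Fin 3) F) * N * (A : Matrix (Fin 3) (Fin 3) F) = M})
    (by simpa [hψA, oneBlock_apply] using hmem slA) (by simpa [hψB, oneBlock_apply] using hmem slB)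
  have hform : ∀ g ∈ G, ∃ y, ∃ c : F, c ≠ 0 ∧ restrictW P g = c • φ y := fun g hg => by
    obtain ⟨y, c, h⟩ := exists_restrictW_eq_smul hG hφ hr hg
    refine ⟨y, c, ?_, h⟩
    rintro rfl
    have := (hG g hg).apply_mul_det_restrictW P
    simp [h] at this
  have h00 : ∀ g ∈ G, ((↑A⁻¹ : Matrix (Fin 3) (Fin 3) F) * g.1 * (A : Matrix (Fin 3) (Fin 3) F)) 0 0 =
      g 0 0 := fun g hg => by
    obtain ⟨y, c, hc, h⟩ := hform g hg
    rw [(hconj g hg y c h).2, (hconj g hg y c h).1]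
    simp [oneBlock_apply, blockMat]
  rw [← hmap] at e
  · exact ⟨e.trans ((weightRing F n).equivMapOfInjective _ basicInvMap_injective).symm.toRingEquiv⟩
  · rintro _ ⟨_, ⟨g, hg, rfl⟩, rfl⟩
    obtain ⟨y, c, hc, h⟩ := hform g hg
    refine ⟨c, oneBlock (ψ y), hc, fun p hp => hp.polyAct_oneBlock hψA hψB y, (hconj g hg y c h).2, ?_⟩
    rw [h00 g hg, (hconj g hg y c h).1]
  · refine fun z => (hn z).trans ⟨?_, fun h g hg => ?_⟩
    · rintro h _ ⟨_, ⟨g, hg, rfl⟩, rfl⟩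
      rw [h00 g hg, h g hg]
    · rw [← h00 g hg]
      exact h _ ⟨_, ⟨g, hg, rfl⟩, rfl⟩

end

/-- Chapter A, case `p = 3`, `𝔽₉ ⊆ F`, `T(G)|W ≅ SL(2, 𝔽₅)` with
`T(G)|W ⊆ SL(2, 𝔽₉)`: `S(V)^G` is Gorenstein iff every `g|W` is a 20-th root of unity
multiple of some `τ|W` with `τ ∈ T(G)`. -/
theorem stmt5 (F : Type u) [Field F] [CharP F 3]
    (hF9 : ∃ S : Finset F, S.card = 9 ∧ ∀ x ∈ S, x ^ (9 : ℕ) = x)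
    (G : Subgroup (Matrix.SpecialLinearGroup (Fin 3) F)) [Finite G]
    (hblock : ∀ g ∈ G, (g : Matrix (Fin 3) (Fin 3) F) 0 1 = 0 ∧
      (g : Matrix (Fin 3) (Fin 3) F) 0 2 = 0 ∧ (g : Matrix (Fin 3) (Fin 3) F) 1 0 = 0 ∧
      (g : Matrix (Fin 3) (Fin 3) F) 2 0 = 0)
    (P : (Matrix (Fin 2) (Fin 2) F)ˣ)
    (hiso : ∃ φ : Matrix.SpecialLinearGroup (Fin 2) (ZMod 5) →* Matrix (Fin 2) (Fin 2) F,
      Function.Injective φ ∧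
        Set.range φ = {M : Matrix (Fin 2) (Fin 2) F | ∃ τ ∈ transSubgroup G, restrictW P τ = M})
    (hsub : ∀ τ ∈ transSubgroup G, (restrictW P τ).det = 1 ∧
      ∀ i j : Fin 2, (restrictW P τ i j) ^ (9 : ℕ) = restrictW P τ i j) :
    IsGorensteinRing ↥(invariantRing G) ↔
      ∀ g ∈ G, ∃ τ ∈ transSubgroup G, ∃ ζ : F, ζ ^ (20 : ℕ) = 1 ∧
        restrictW P g = ζ • restrictW P τ := by
  obtain ⟨φ, hφ, hr⟩ := hiso
  obtain ⟨n, hn0, hn⟩ := exists_dvd_iff_zpow_eq_one hblock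
  obtain ⟨e⟩ := nonempty_invariantRing_equiv hblock hφ hr hn
  constructor
  · intro h g hg
    obtain ⟨y, c, hc⟩ := exists_restrictW_eq_smul hblock hφ hr hg
    obtain ⟨τ, hτ, hy⟩ : φ y ∈ {M | ∃ τ ∈ transSubgroup G, restrictW P τ = M} := hr ▸ ⟨y, rfl⟩
    rw [← hy] at hc
    refine ⟨τ, hτ, c, ?_, hc⟩
    have h1 := (hn 10).1
      (mod_cast dvd_ten_of_isGorensteinRing hn0 (IsGorensteinRing.of_ringEquiv e h)) g hg
    rw [apply_zero_zero_eq hblock hg (hsub τ hτ).1 hc, zpow_ofNat, inv_pow, inv_eq_one,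
      ← pow_mul] at h1
    exact h1
  · intro h
    refine IsGorensteinRing.of_ringEquiv e.symm (isGorensteinRing_weightRing F hn0 ?_)
    have : (n : ℤ) ∣ 10 := (hn 10).2 fun g hg => by
      obtain ⟨τ, hτ, c, hc, e⟩ := h g hg
      rw [apply_zero_zero_eq hblock hg (hsub τ hτ).1 e, zpow_ofNat, inv_pow, inv_eq_one, ← pow_mul]
      exact hc
    exact_mod_cast this

end
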